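/- arXiv:1305.6674 — 5 statements merged into one kernel-verified Lean document; each statement's English description precedes it below -/
import Mathlib

section
/- Let B be the order-q-subplane of PG(2,q³) consisting of the q²+q+1 points T = (1:0:0), P_{e,d} = (e+dτ : e : e+τ) for e,d ∈ K, and U_f = (1+fτ : 1 : 1) for f ∈ K; B is tangent to ℓ∞ at T. Fix e,d ∈ K and let P = P_{e,d}. Let m := {n ∩ ℓ∞ : n a line of PG(2,q³) containing P and at least two points of B}, which is an order-q-subline of ℓ∞ through T, and let P^⊥ (the tangent subspace of P) be the unique order-q-subplane of PG(2,q³) containing both m and B ∩ TP, where TP is the line of PG(2,q³) through T and P. Then the set of Bruck–Bose images of the points of P^⊥ ∖ ℓ∞ is exactly the set of points with nonzero last coordinate of the plane of ℙ_K(L×L×K) whose underlying 3-dimensional K-subspace is spanned by the vectors ((e+dτ)θ⁻(e), eθ⁻(e), θ(e)), (τθ⁻(e), 0, 0) and ((1−d)τθ⁻(e)², τθ⁻(e)², 0). -/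
open scoped LinearAlgebra.Projectivization
open Module

noncomputable section

/-- The action of an invertible L-linear map on the points of PG(2,q³) = ℙ L (Fin 3 → L).
Projectivities of PG(2,q³), i.e. elements of PGL(3,L), are exactly the maps of this form. -/
def actGL3 (L : Type*) [Field L] (g : LinearMap.GeneralLinearGroup L (Fin 3 → L))
    (P : ℙ L (Fin 3 → L)) : ℙ L (Fin 3 → L) :=
  Projectivization.map g.toLinearEquiv.toLinearMap g.toLinearEquiv.injective P

/-- The set of K-rational points {(x:y:z) : (x,y,z) ∈ K³ ∖ {0}} of PG(2,q³). -/
def stdSubplane (K L : Type*) [Field K] [Field L] [Algebra K L] : Set (ℙ L (Fin 3 → L)) :=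
  {P | ∃ (v : Fin 3 → K) (h : (fun i => algebraMap K L (v i)) ≠ 0),
    P = Projectivization.mk L (fun i => algebraMap K L (v i)) h}

/-- The standard subline {(x:y:0) : (x,y) ∈ K² ∖ {0}} of PG(2,q³). -/
def stdSubline (K L : Type*) [Field K] [Field L] [Algebra K L] : Set (ℙ L (Fin 3 → L)) :=
  {P | ∃ (v : Fin 3 → K) (h : (fun i => algebraMap K L (v i)) ≠ 0),
    v 2 = 0 ∧ P = Projectivization.mk L (fun i => algebraMap K L (v i)) h}

/-- An order-q-subplane of PG(2,q³): the image of the set of K-rational points under an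
element of PGL(3,L). -/
def IsOSubplane (K L : Type*) [Field K] [Field L] [Algebra K L]
    (S : Set (ℙ L (Fin 3 → L))) : Prop :=
  ∃ g : LinearMap.GeneralLinearGroup L (Fin 3 → L), S = actGL3 L g '' stdSubplane K L

/-- An order-q-subline of PG(2,q³): the image of the standard subline under an element of
PGL(3,L). -/
def IsOSubline (K L : Type*) [Field K] [Field L] [Algebra K L]
    (S : Set (ℙ L (Fin 3 → L))) : Prop :=
  ∃ g : LinearMap.GeneralLinearGroup L (Fin 3 → L), S = actGL3 L g '' stdSubline K L

/-- The line at infinity ℓ∞ = {(x:y:z) : z = 0} of PG(2,q³). -/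
def linfty (L : Type*) [Field L] : Set (ℙ L (Fin 3 → L)) :=
  {P | P.rep 2 = 0}

/-- The tangent splash of a set B of points of PG(2,q³): the set of points of ℓ∞ lying on a
line of PG(2,q³) spanned by two distinct points of B. -/
def splashOf (L : Type*) [Field L] (Bs : Set (ℙ L (Fin 3 → L))) : Set (ℙ L (Fin 3 → L)) :=
  {P | P ∈ linfty L ∧ ∃ A₁ ∈ Bs, ∃ A₂ ∈ Bs, A₁ ≠ A₂ ∧
    P.submodule ≤ A₁.submodule ⊔ A₂.submodule}

/-- The Bruck–Bose image in the 7-dimensional K-vector space (L × L) × K of (a representing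
vector of) an affine point (α:β:γ) of PG(2,q³): the vector
(α·γ^q·γ^{q²}, β·γ^q·γ^{q²}, N_{L/K}(γ)), where N_{L/K}(γ) = γ^{1+q+q²}. -/
def bbvec (q : ℕ) (K L : Type*) [Field K] [Field L] [Algebra K L]
    (v : Fin 3 → L) : (L × L) × K :=
  ((v 0 * (v 2 ^ q * v 2 ^ q ^ 2), v 1 * (v 2 ^ q * v 2 ^ q ^ 2)), Algebra.norm K (v 2))

/-- The hyperplane at infinity Σ∞ of ℙ_K((L × L) × K): the points with last coordinate 0. -/
def SigmaInf (K L : Type*) [Field K] [Field L] [Algebra K L] :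
    Submodule K ((L × L) × K) :=
  (⊤ : Submodule K (L × L)).prod (⊥ : Submodule K K)

section helpers

variable {K L : Type} [Field K] [Field L] [Algebra K L]

/-- Projective points represented by nonzero vectors of a K-subspace. -/
def PS (V : Submodule K (Fin 3 → L)) : Set (ℙ L (Fin 3 → L)) :=
  {X | ∃ v ∈ V, ∃ h : v ≠ 0, X = Projectivization.mk L v h}

/-- Linear independence of three vectors, spelled out. -/
def LI3 (w₁ w₂ w₃ : Fin 3 → L) : Prop :=
  ∀ x y z : L, x • w₁ + y • w₂ + z • w₃ = 0 → x = 0 ∧ y = 0 ∧ z = 0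

lemma LI3.li {w₁ w₂ w₃ : Fin 3 → L} (h : LI3 w₁ w₂ w₃) : LinearIndependent L ![w₁, w₂, w₃] := by
  rw [Fintype.linearIndependent_iff]
  intro g hg
  have := h (g 0) (g 1) (g 2) (by simpa [Fin.sum_univ_three] using hg)
  intro i
  fin_cases i
  · exact this.1
  · exact this.2.1
  · exact this.2.2

lemma LI3.exists_gl {w₁ w₂ w₃ : Fin 3 → L} (h : LI3 w₁ w₂ w₃) :
    ∃ g : LinearMap.GeneralLinearGroup L (Fin 3 → L), ∀ v : Fin 3 → L,
      g.toLinearEquiv v = v 0 • w₁ + v 1 • w₂ + v 2 • w₃ := by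
  let b := basisOfLinearIndependentOfCardEqFinrank h.li (by simp)
  refine ⟨LinearMap.GeneralLinearGroup.ofLinearEquiv
    ((Pi.basisFun L (Fin 3)).equiv b (Equiv.refl _)), fun v => ?_⟩
  have hv : v = v 0 • Pi.basisFun L (Fin 3) 0 + v 1 • Pi.basisFun L (Fin 3) 1
      + v 2 • Pi.basisFun L (Fin 3) 2 := by
    ext i; fin_cases i <;> simp
  have key : (Pi.basisFun L (Fin 3)).equiv b (Equiv.refl _) v
      = v 0 • w₁ + v 1 • w₂ + v 2 • w₃ := by
    conv_lhs => rw [hv]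
    simp only [map_add, map_smul, Basis.equiv_apply]
    simp [b]
  exact key

lemma act_mk (g : LinearMap.GeneralLinearGroup L (Fin 3 → L)) (v : Fin 3 → L) (h : v ≠ 0)
    (h' : g.toLinearEquiv v ≠ 0) :
    actGL3 L g (Projectivization.mk L v h) = Projectivization.mk L (g.toLinearEquiv v) h' := rfl

lemma gl_ne (g : LinearMap.GeneralLinearGroup L (Fin 3 → L)) {v : Fin 3 → L} (h : v ≠ 0) :
    g.toLinearEquiv v ≠ 0 := (LinearEquiv.map_ne_zero_iff _).2 h

lemma mk_congr {v w : Fin 3 → L} (h : v ≠ 0) (e : v = w) :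
    Projectivization.mk L v h = Projectivization.mk L w (e ▸ h) := by subst e; rfl

lemma LI3.sub {w₁ w₂ w₃ : Fin 3 → L} (h : LI3 w₁ w₂ w₃) :
    IsOSubplane K L (PS (Submodule.span K {w₁, w₂, w₃})) := by
  obtain ⟨g, hg⟩ := h.exists_gl
  refine ⟨g, ?_⟩
  ext X
  constructor
  · rintro ⟨v, hv, h0, rfl⟩
    obtain ⟨a, b, c, rfl⟩ := Submodule.mem_span_triple.1 hv
    have e : g.toLinearEquiv (fun i => algebraMap K L ((![a, b, c] : Fin 3 → K) i))
        = a • w₁ + b • w₂ + c • w₃ := by rw [hg]; simp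
    have hne : (fun i => algebraMap K L ((![a, b, c] : Fin 3 → K) i)) ≠ 0 := by
      intro hh
      rw [hh, map_zero] at e
      exact h0 e.symm
    refine ⟨_, ⟨![a, b, c], hne, rfl⟩, ?_⟩
    rw [act_mk _ _ _ (gl_ne g hne)]
    exact mk_congr _ e
  · rintro ⟨_, ⟨v, h0, rfl⟩, rfl⟩
    rw [act_mk _ _ _ (gl_ne g h0)]
    refine ⟨_, ?_, gl_ne g h0, rfl⟩
    rw [hg]
    exact Submodule.mem_span_triple.2 ⟨v 0, v 1, v 2, by simp⟩

lemma LI3.subline {w₁ w₂ w₃ : Fin 3 → L} (h : LI3 w₁ w₂ w₃) :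
    IsOSubline K L (PS (Submodule.span K {w₁, w₂})) := by
  obtain ⟨g, hg⟩ := h.exists_gl
  refine ⟨g, ?_⟩
  ext X
  constructor
  · rintro ⟨v, hv, h0, rfl⟩
    obtain ⟨a, b, rfl⟩ := Submodule.mem_span_pair.1 hv
    have e : g.toLinearEquiv (fun i => algebraMap K L ((![a, b, 0] : Fin 3 → K) i))
        = a • w₁ + b • w₂ := by rw [hg]; simp
    have hne : (fun i => algebraMap K L ((![a, b, 0] : Fin 3 → K) i)) ≠ 0 := by
      intro hh
      rw [hh, map_zero] at e
      exact h0 e.symm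
    refine ⟨_, ⟨![a, b, 0], hne, rfl, rfl⟩, ?_⟩
    rw [act_mk _ _ _ (gl_ne g hne)]
    exact mk_congr _ e
  · rintro ⟨_, ⟨v, h0, h2, rfl⟩, rfl⟩
    rw [act_mk _ _ _ (gl_ne g h0)]
    refine ⟨_, ?_, gl_ne g h0, rfl⟩
    rw [hg]
    exact Submodule.mem_span_pair.2 ⟨v 0, v 1, by simp [h2]⟩

/-- Every order-q-subplane comes from a K-subspace of dimension at most 3. -/
lemma sub_exists {S : Set (ℙ L (Fin 3 → L))} (h : IsOSubplane K L S) :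
    ∃ V : Submodule K (Fin 3 → L), FiniteDimensional K V ∧ finrank K V ≤ 3 ∧ S = PS V := by
  obtain ⟨g, rfl⟩ := h
  let w : Fin 3 → (Fin 3 → L) := fun i => g.toLinearEquiv (Pi.single i 1)
  have hg : ∀ v : Fin 3 → L, g.toLinearEquiv v = v 0 • w 0 + v 1 • w 1 + v 2 • w 2 := by
    intro v
    have hv : v = v 0 • Pi.single 0 1 + v 1 • Pi.single 1 1 + v 2 • Pi.single 2 1 := by
      ext i; fin_cases i <;> simp
    conv_lhs => rw [hv]
    simp only [map_add, map_smul, w]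
  have hli : LI3 (w 0) (w 1) (w 2) := by
    intro x y z h
    have := hg ![x, y, z]
    simp only [Matrix.cons_val] at this
    rw [h, LinearEquiv.map_eq_zero_iff] at this
    exact ⟨congrFun this 0, congrFun this 1, congrFun this 2⟩
  refine ⟨Submodule.span K {w 0, w 1, w 2}, ?_, ?_, ?_⟩
  · exact FiniteDimensional.span_of_finite K (by simp)
  · classical
    have := finrank_span_finset_le_card (R := K) ({w 0, w 1, w 2} : Finset (Fin 3 → L))
    rw [Set.finrank] at this
    have hs : (({w 0, w 1, w 2} : Finset (Fin 3 → L)) : Set (Fin 3 → L)) = {w 0, w 1, w 2} := by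
      simp
    rw [hs] at this
    exact this.trans Finset.card_le_three
  · ext X
    constructor
    · rintro ⟨_, ⟨v, h0, rfl⟩, rfl⟩
      rw [act_mk _ _ _ (gl_ne g h0)]
      refine ⟨_, ?_, gl_ne g h0, rfl⟩
      rw [hg]
      exact Submodule.mem_span_triple.2 ⟨v 0, v 1, v 2, by simp⟩
    · rintro ⟨v, hv, h0, rfl⟩
      obtain ⟨a, b, c, rfl⟩ := Submodule.mem_span_triple.1 hv
      have e : g.toLinearEquiv (fun i => algebraMap K L ((![a, b, c] : Fin 3 → K) i))
          = a • w 0 + b • w 1 + c • w 2 := by rw [hg]; simp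
      have hne : (fun i => algebraMap K L ((![a, b, c] : Fin 3 → K) i)) ≠ 0 := by
        intro hh
        rw [hh, map_zero] at e
        exact h0 e.symm
      refine ⟨_, ⟨![a, b, c], hne, rfl⟩, ?_⟩
      rw [act_mk _ _ _ (gl_ne g hne)]
      exact mk_congr _ e

lemma mem_PS {V : Submodule K (Fin 3 → L)} {v : Fin 3 → L} (h : v ≠ 0) :
    Projectivization.mk L v h ∈ PS V ↔ ∃ c : L, c ≠ 0 ∧ c • v ∈ V := by
  constructor
  · rintro ⟨w, hw, hw0, e⟩
    obtain ⟨a, ha⟩ := (Projectivization.mk_eq_mk_iff' L _ _ _ _).1 e.symm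
    exact ⟨a, by rintro rfl; simp at ha; exact hw0 ha.symm, ha ▸ hw⟩
  · rintro ⟨c, hc, hv⟩
    refine ⟨_, hv, smul_ne_zero hc h, ?_⟩
    exact (Projectivization.mk_eq_mk_iff' L _ _ _ _).2 ⟨c⁻¹, by simp [smul_smul, hc]⟩

lemma LI3.finrank {w₁ w₂ w₃ : Fin 3 → L} (h : LI3 w₁ w₂ w₃) :
    finrank K (Submodule.span K {w₁, w₂, w₃}) = 3 := by
  have h1 : LinearIndependent K ![w₁, w₂, w₃] := h.li.restrict_scalars (by
    intro a b hab
    simpa [Algebra.smul_def] using hab)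
  have := finrank_span_eq_card h1
  have hr : Set.range ![w₁, w₂, w₃] = {w₁, w₂, w₃} := by
    ext x
    simp [eq_comm]
    tauto
  rw [hr] at this
  simpa using this

lemma LI3.smul {w₁ w₂ w₃ : Fin 3 → L} (h : LI3 w₁ w₂ w₃) {a b c : L} (ha : a ≠ 0) (hb : b ≠ 0)
    (hc : c ≠ 0) : LI3 (a • w₁) (b • w₂) (c • w₃) := by
  intro x y z hh
  simp only [smul_smul] at hh
  have := h _ _ _ hh
  simpa [ha, hb, hc] using this

lemma PS_unique {w₁ w₂ w₃ : Fin 3 → L} (h : LI3 w₁ w₂ w₃) {C : Set (ℙ L (Fin 3 → L))}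
    (hC : IsOSubplane K L C)
    (h1 : ∀ h : w₁ ≠ 0, Projectivization.mk L w₁ h ∈ C)
    (h2 : ∀ h : w₂ ≠ 0, Projectivization.mk L w₂ h ∈ C)
    (h3 : ∀ h : w₃ ≠ 0, Projectivization.mk L w₃ h ∈ C)
    (h12 : ∀ h : w₁ + w₂ ≠ 0, Projectivization.mk L (w₁ + w₂) h ∈ C)
    (h13 : ∀ h : w₁ + w₃ ≠ 0, Projectivization.mk L (w₁ + w₃) h ∈ C) :
    C = PS (Submodule.span K {w₁, w₂, w₃}) := by
  obtain ⟨V, hfin, hV, rfl⟩ := sub_exists hC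
  have n1 : w₁ ≠ 0 := by rintro rfl; simpa using h 1 0 0 (by simp)
  have n2 : w₂ ≠ 0 := by rintro rfl; simpa using h 0 1 0 (by simp)
  have n3 : w₃ ≠ 0 := by rintro rfl; simpa using h 0 0 1 (by simp)
  have n12 : w₁ + w₂ ≠ 0 := by intro hh; simpa using h 1 1 0 (by simpa using hh)
  have n13 : w₁ + w₃ ≠ 0 := by intro hh; simpa using h 1 0 1 (by simpa using hh)
  obtain ⟨a, ha, ha'⟩ := (mem_PS n1).1 (h1 n1)
  obtain ⟨b, hb, hb'⟩ := (mem_PS n2).1 (h2 n2)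
  obtain ⟨c, hc, hc'⟩ := (mem_PS n3).1 (h3 n3)
  obtain ⟨s, hs, hs'⟩ := (mem_PS n12).1 (h12 n12)
  obtain ⟨t, ht, ht'⟩ := (mem_PS n13).1 (h13 n13)
  have e : Submodule.span K {a • w₁, b • w₂, c • w₃} = V := by
    apply Submodule.eq_of_le_of_finrank_le
    · rw [Submodule.span_le]
      rintro x (rfl | rfl | rfl) <;> assumption
    · rw [(h.smul ha hb hc).finrank]; exact hV
  rw [← e] at hs' ht'
  obtain ⟨x, y, z, hx⟩ := Submodule.mem_span_triple.1 hs'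
  obtain ⟨x', y', z', hx'⟩ := Submodule.mem_span_triple.1 ht'
  have q1 := h (algebraMap K L x * a - s) (algebraMap K L y * b - s) (algebraMap K L z * c) (by
    rw [← sub_eq_zero] at hx
    rw [← hx]
    ext i
    simp [Algebra.smul_def]
    ring)
  have q2 := h (algebraMap K L x' * a - t) (algebraMap K L y' * b) (algebraMap K L z' * c - t) (by
    rw [← sub_eq_zero] at hx'
    rw [← hx']
    ext i
    simp [Algebra.smul_def]
    ring)
  have ya : algebraMap K L x * a = algebraMap K L y * b := by linear_combination q1.1 - q1.2.1
  have za : algebraMap K L x' * a = algebraMap K L z' * c := by linear_combination q2.1 - q2.2.2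
  have x0 : x ≠ 0 := by rintro rfl; apply hs; simpa using q1.1
  have x0' : x' ≠ 0 := by rintro rfl; apply ht; simpa using q2.1
  have y0 : y ≠ 0 := by rintro rfl; apply hs; simpa using q1.2.1
  have z0' : z' ≠ 0 := by rintro rfl; apply ht; simpa using q2.2.2
  have hb2 : b = algebraMap K L (x / y) * a := by
    rw [map_div₀]; field_simp; rw [ya]; field_simp
    simp [y0]
  have hc2 : c = algebraMap K L (x' / z') * a := by
    rw [map_div₀]; field_simp; rw [za]; field_simp
    simp [z0']
  have e2 : ∀ v, v ∈ V ↔ a⁻¹ • v ∈ Submodule.span K {w₁, w₂, w₃} := by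
    intro v
    rw [← e, Submodule.mem_span_triple, Submodule.mem_span_triple]
    constructor
    · rintro ⟨k1, k2, k3, rfl⟩
      refine ⟨k1, k2 * (x / y), k3 * (x' / z'), ?_⟩
      rw [hb2, hc2]
      ext i
      simp only [Algebra.smul_def, Pi.add_apply, Pi.smul_apply, map_mul,
        Pi.mul_apply, Pi.algebraMap_apply, Algebra.algebraMap_self, RingHom.id_apply]
      field_simp
    · rintro ⟨k1, k2, k3, hk⟩
      refine ⟨k1, k2 * (y / x), k3 * (z' / x'), ?_⟩
      have : v = a • (a⁻¹ • v) := by simp [smul_smul, ha]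
      rw [this, ← hk, hb2, hc2]
      ext i
      simp only [Algebra.smul_def, Pi.add_apply, Pi.smul_apply, map_mul,
        Pi.mul_apply, Pi.algebraMap_apply, Algebra.algebraMap_self, RingHom.id_apply, map_div₀]
      have : algebraMap K L x ≠ 0 := by simpa using x0
      have : algebraMap K L y ≠ 0 := by simpa using y0
      have : algebraMap K L x' ≠ 0 := by simpa using x0'
      have : algebraMap K L z' ≠ 0 := by simpa using z0'
      field_simp
  ext X
  induction X using Projectivization.ind with
  | h v hv =>
    rw [mem_PS, mem_PS]
    constructor
    · rintro ⟨r, hr, hh⟩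
      exact ⟨a⁻¹ * r, by simp [ha, hr], by rw [mul_smul]; exact (e2 _).1 hh⟩
    · rintro ⟨r, hr, hh⟩
      exact ⟨a * r, by simp [ha, hr], (e2 _).2 (by simpa [smul_smul, ha] using hh)⟩

lemma mk_mem_linfty {v : Fin 3 → L} (h : v ≠ 0) :
    Projectivization.mk L v h ∈ linfty L ↔ v 2 = 0 := by
  obtain ⟨a, ha⟩ := Projectivization.exists_smul_eq_mk_rep L v h
  change (Projectivization.mk L v h).rep 2 = 0 ↔ _
  rw [← ha]
  simp [Units.smul_def]

lemma mk_sub_le {F E : Type} [Field F] [AddCommGroup E] [Module F E]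
    {v : E} (h : v ≠ 0) (n : Submodule F E) :
    (Projectivization.mk F v h).submodule ≤ n ↔ v ∈ n := by
  rw [Projectivization.submodule_mk, Submodule.span_singleton_le_iff_mem]

lemma exists_dep {n : Submodule L (Fin 3 → L)} (hn : finrank L n = 2) {x y z : Fin 3 → L}
    (hx : x ∈ n) (hy : y ∈ n) (hz : z ∈ n) : ¬ LI3 x y z := by
  intro h
  have h3 : finrank L (Submodule.span L {x, y, z}) = 3 := h.finrank
  have hle : Submodule.span L {x, y, z} ≤ n := by
    rw [Submodule.span_le]
    rintro w (rfl | rfl | rfl) <;> assumption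
  have := Submodule.finrank_mono hle
  omega

end helpers
section helpers2

variable {K L : Type} [Field K] [Field L] [Algebra K L]

lemma Bs_eq (τ : L) (hτ : ∀ x y : K, algebraMap K L x + algebraMap K L y * τ = 0 → x = 0 ∧ y = 0) :
    {X : ℙ L (Fin 3 → L) |
      (∃ h : (![1, 0, 0] : Fin 3 → L) ≠ 0, X = Projectivization.mk L ![1, 0, 0] h) ∨
      (∃ e' d' : K, ∃ h : (![algebraMap K L e' + algebraMap K L d' * τ, algebraMap K L e',
          algebraMap K L e' + τ] : Fin 3 → L) ≠ 0,
        X = Projectivization.mk L ![algebraMap K L e' + algebraMap K L d' * τ,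
          algebraMap K L e', algebraMap K L e' + τ] h) ∨
      (∃ f : K, ∃ h : (![1 + algebraMap K L f * τ, 1, 1] : Fin 3 → L) ≠ 0,
        X = Projectivization.mk L ![1 + algebraMap K L f * τ, 1, 1] h)} =
    PS (Submodule.span K {![τ, 0, 0], ![1, 1, 1], ![0, 0, τ]}) := by
  have t0 : τ ≠ 0 := by rintro rfl; simpa using hτ 0 1
  ext X
  constructor
  · rintro (⟨h, rfl⟩ | ⟨e, d, h, rfl⟩ | ⟨f, h, rfl⟩)
    · rw [mem_PS]
      refine ⟨τ, t0, Submodule.mem_span_triple.2 ⟨1, 0, 0, ?_⟩⟩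
      ext i; fin_cases i <;> simp
    · rw [mem_PS]
      refine ⟨1, one_ne_zero, Submodule.mem_span_triple.2 ⟨d, e, 1, ?_⟩⟩
      ext i; fin_cases i <;> simp [Algebra.smul_def, add_comm]
    · rw [mem_PS]
      refine ⟨1, one_ne_zero, Submodule.mem_span_triple.2 ⟨f, 1, 0, ?_⟩⟩
      ext i; fin_cases i <;> simp <;> simp [Algebra.smul_def, add_comm]
  · rintro ⟨v, hv, h0, rfl⟩
    obtain ⟨x, y, z, rfl⟩ := Submodule.mem_span_triple.1 hv
    by_cases hz : z = 0
    · by_cases hy : y = 0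
      · left
        refine ⟨by intro h; simpa using congrFun h 0, ?_⟩
        rw [Projectivization.mk_eq_mk_iff']
        refine ⟨algebraMap K L x * τ, ?_⟩
        ext i; fin_cases i <;> simp [Algebra.smul_def, hz, hy]
      · right; right
        refine ⟨x / y, by intro h; simpa using congrFun h 1, ?_⟩
        rw [Projectivization.mk_eq_mk_iff']
        refine ⟨algebraMap K L y, ?_⟩
        have : algebraMap K L y ≠ 0 := by simpa using hy
        ext i; fin_cases i <;> simp [Algebra.smul_def, hz]
        field_simp
        ring
    · right; left
      have hz' : algebraMap K L z ≠ 0 := by simpa using hz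
      refine ⟨y / z, x / z, ?_, ?_⟩
      · intro h
        have := hτ (y / z) 1 (by simpa using congrFun h 2)
        simp at this
      · rw [Projectivization.mk_eq_mk_iff']
        refine ⟨algebraMap K L z, ?_⟩
        ext i; fin_cases i <;> simp [Algebra.smul_def] <;> field_simp
        ring

lemma li_B (τ : L) (t0 : τ ≠ 0) : LI3 ![τ, 0, 0] ![1, 1, 1] ![0, 0, τ] := by
  intro x y z h
  have h0 := congrFun h 0
  have h1 := congrFun h 1
  have h2 := congrFun h 2
  simp at h0 h1 h2
  simp [h1, t0] at h0 h2
  exact ⟨h0, h1, h2⟩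

lemma li_U {τ x y u v w : L} (t0 : τ ≠ 0) (hy : y ≠ 0) (hw : w ≠ 0) :
    LI3 ![τ, 0, 0] ![x, y, 0] ![u, v, w] := by
  intro x y z h
  have h0 := congrFun h 0
  have h1 := congrFun h 1
  have h2 := congrFun h 2
  simp [hw] at h2
  simp [h2, hy] at h1
  simp [h1, h2, t0] at h0
  exact ⟨h0, h1, h2⟩

/-- The key description of the subline m. -/
lemma m_eq (τ : L) (hτ : ∀ x y : K, algebraMap K L x + algebraMap K L y * τ = 0 → x = 0 ∧ y = 0)
    (e d : K) (Pv : Fin 3 → L)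
    (hPv : Pv = ![algebraMap K L e + algebraMap K L d * τ, algebraMap K L e,
      algebraMap K L e + τ]) (hPv0 : Pv ≠ 0) (Bs : Set (ℙ L (Fin 3 → L)))
    (hBs : Bs = PS (Submodule.span K {![τ, 0, 0], ![1, 1, 1], ![0, 0, τ]})) :
    {X : ℙ L (Fin 3 → L) | X ∈ linfty L ∧
      ∃ n : Submodule L (Fin 3 → L), Module.finrank L n = 2 ∧
        (Projectivization.mk L Pv hPv0).submodule ≤ n ∧
        (∃ A₁ ∈ Bs, ∃ A₂ ∈ Bs, A₁ ≠ A₂ ∧ A₁.submodule ≤ n ∧ A₂.submodule ≤ n) ∧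
        X.submodule ≤ n} =
    PS (Submodule.span K {![τ, 0, 0], ![algebraMap K L (1 - d) * τ * (algebraMap K L e + τ)⁻¹,
      τ * (algebraMap K L e + τ)⁻¹, 0]}) := by
  have t0 : τ ≠ 0 := by rintro rfl; simpa using hτ 0 1
  have s0 : algebraMap K L e + τ ≠ 0 := by
    intro h; simpa using hτ e 1 (by simpa using h)
  have hPe : Pv = d • ![τ, 0, 0] + e • ![1, 1, 1] + (1 : K) • ![0, 0, τ] := by
    rw [hPv]; ext i; fin_cases i <;> simp [Algebra.smul_def, add_comm]
  -- reduction modulo P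
  have hred : ∀ x y : K, x • ![τ, 0, 0] + y • ![algebraMap K L (1 - d) * τ *
        (algebraMap K L e + τ)⁻¹, τ * (algebraMap K L e + τ)⁻¹, 0]
      = (x • ![τ, 0, 0] + y • ![1, 1, 1]) - (algebraMap K L y * (algebraMap K L e + τ)⁻¹) • Pv := by
    intro x y
    rw [hPv]
    ext i; fin_cases i <;> simp [Algebra.smul_def] <;> field_simp <;> ring
  have hne : ∀ x y : K, (x ≠ 0 ∨ y ≠ 0) → x • ![τ, 0, 0] + y • ![algebraMap K L (1 - d) * τ *
        (algebraMap K L e + τ)⁻¹, τ * (algebraMap K L e + τ)⁻¹, 0] ≠ 0 := by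
    intro x y hxy h
    have h0 := congrFun h 0
    have h1 := congrFun h 1
    simp [Algebra.smul_def, t0, s0] at h1
    simp [h1, Algebra.smul_def, t0] at h0
    tauto
  ext X
  constructor
  · rintro ⟨hX, n, hn, hPn, ⟨A₁, hA₁, A₂, hA₂, hne12, h1, h2⟩, hXn⟩
    have hA : ∃ A ∈ Bs, A.submodule ≤ n ∧ A ≠ Projectivization.mk L Pv hPv0 := by
      by_cases h : A₁ = Projectivization.mk L Pv hPv0
      · exact ⟨A₂, hA₂, h2, fun hh => hne12 (h.trans hh.symm)⟩
      · exact ⟨A₁, hA₁, h1, h⟩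
    obtain ⟨A, hA, hAn, hAP⟩ := hA
    rw [hBs] at hA
    obtain ⟨v, hv, hv0, rfl⟩ := hA
    obtain ⟨x, y, z, rfl⟩ := Submodule.mem_span_triple.1 hv
    rw [mk_sub_le] at hAn hPn
    have hkk : x - z * d ≠ 0 ∨ y - z * e ≠ 0 := by
      by_contra! hc
      obtain ⟨c1, c2⟩ := hc
      rw [sub_eq_zero] at c1 c2
      apply hAP
      rw [Projectivization.mk_eq_mk_iff']
      refine ⟨algebraMap K L z, ?_⟩
      rw [hPe, c1, c2]
      generalize (![τ, 0, 0] : Fin 3 → L) = W1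
      generalize (![1, 1, 1] : Fin 3 → L) = W2
      generalize (![0, 0, τ] : Fin 3 → L) = W3
      ext i
      simp [Algebra.smul_def]
      ring
    have hin : (x - z * d) • ![τ, 0, 0] + (y - z * e) • ![1, 1, 1] ∈ n := by
      have : (x - z * d) • (![τ, 0, 0] : Fin 3 → L) + (y - z * e) • (![1, 1, 1] : Fin 3 → L)
        = (x • (![τ, 0, 0] : Fin 3 → L) + y • (![1, 1, 1] : Fin 3 → L)
          + z • (![0, 0, τ] : Fin 3 → L)) - (algebraMap K L z) • Pv := by
        rw [hPe]
        generalize (![τ, 0, 0] : Fin 3 → L) = W1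
        generalize (![1, 1, 1] : Fin 3 → L) = W2
        generalize (![0, 0, τ] : Fin 3 → L) = W3
        ext i
        simp [Algebra.smul_def]
        ring
      rw [this]
      exact n.sub_mem hAn (n.smul_mem _ hPn)
    have hin2 : (x - z * d) • ![τ, 0, 0] + (y - z * e) • ![algebraMap K L (1 - d) * τ *
        (algebraMap K L e + τ)⁻¹, τ * (algebraMap K L e + τ)⁻¹, 0] ∈ n := by
      rw [hred]
      exact n.sub_mem hin (n.smul_mem _ hPn)
    have hnz := hne _ _ hkk
    set Y : Fin 3 → L := (x - z * d) • ![τ, 0, 0] + (y - z * e) • ![algebraMap K L (1 - d) * τ *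
        (algebraMap K L e + τ)⁻¹, τ * (algebraMap K L e + τ)⁻¹, 0] with hY
    have hY2 : Y 2 = 0 := by simp [hY]
    induction X using Projectivization.ind with
    | h w hw =>
      rw [mk_mem_linfty] at hX
      rw [mk_sub_le] at hXn
      rw [mem_PS]
      have hdep := exists_dep hn hPn hin2 hXn
      by_contra hcon
      apply hdep
      intro α β γ hh
      have hP2 : Pv 2 = algebraMap K L e + τ := by rw [hPv]; rfl
      have hα : α = 0 := by
        have := congrFun hh 2
        simpa [hY2, hX, hP2, s0] using this
      subst hα
      rw [zero_smul, zero_add] at hh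
      have hγ : γ = 0 := by
        by_contra hγ
        by_cases hβ : β = 0
        · subst hβ
          simp [hγ, hw] at hh
        apply hcon
        refine ⟨-(γ / β), by simp [hβ, hγ], ?_⟩
        have : -(γ / β) • w = Y := by
          have h3 : β • Y = -(γ • w) := eq_neg_of_add_eq_zero_left hh
          have : Y = β⁻¹ • (β • Y) := by simp [smul_smul, hβ]
          rw [this, h3, neg_smul, smul_neg, smul_smul, div_eq_inv_mul]
        rw [this]
        exact Submodule.mem_span_pair.2 ⟨_, _, rfl⟩
      subst hγ
      simp [hnz] at hh
      exact ⟨rfl, hh, rfl⟩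
  · rintro ⟨v, hv, h0, rfl⟩
    obtain ⟨x, y, rfl⟩ := Submodule.mem_span_pair.1 hv
    have hxy : x ≠ 0 ∨ y ≠ 0 := by
      by_contra! hc
      simp [hc] at h0
    refine ⟨by rw [mk_mem_linfty]; simp, ?_⟩
    have hA0 : x • ![τ, 0, 0] + y • ![1, 1, 1] ≠ 0 := by
      intro h
      have h0 := congrFun h 0
      have h1 := congrFun h 1
      simp [Algebra.smul_def] at h1
      simp [h1, Algebra.smul_def, t0] at h0
      tauto
    set A : Fin 3 → L := x • ![τ, 0, 0] + y • ![1, 1, 1] with hA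
    have hAP : Projectivization.mk L Pv hPv0 ≠ Projectivization.mk L A hA0 := by
      intro h
      obtain ⟨c, hc⟩ := (Projectivization.mk_eq_mk_iff' L _ _ _ _).1 h
      have := li_B τ t0 (c * algebraMap K L x - algebraMap K L d)
        (c * algebraMap K L y - algebraMap K L e) (-1) (by
          rw [hPe, ← sub_eq_zero] at hc
          rw [← hc, hA]
          generalize (![τ, 0, 0] : Fin 3 → L) = W1
          generalize (![1, 1, 1] : Fin 3 → L) = W2
          generalize (![0, 0, τ] : Fin 3 → L) = W3
          ext i
          simp [Algebra.smul_def]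
          ring)
      simp at this
    refine ⟨Submodule.span L {Pv, A}, ?_, ?_, ⟨_, ?_, _, ?_, hAP, ?_, ?_⟩, ?_⟩
    · have hli : LinearIndependent L ![Pv, A] := by
        rw [LinearIndependent.pair_iff' hPv0]
        intro a ha
        exact hAP ((Projectivization.mk_eq_mk_iff' L _ _ _ _).2 ⟨a, ha⟩).symm
      have := finrank_span_eq_card hli
      have hr : Set.range ![Pv, A] = {Pv, A} := by
        ext x
        simp [eq_comm]
        tauto
      rw [hr] at this
      simpa using this
    · rw [mk_sub_le]; exact Submodule.subset_span (by simp)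
    · rw [hBs, mem_PS]
      exact ⟨1, one_ne_zero, by rw [one_smul]; exact Submodule.mem_span_triple.2 ⟨d, e, 1, hPe.symm⟩⟩
    · rw [hBs, mem_PS]
      exact ⟨1, one_ne_zero, by
        rw [one_smul]; exact Submodule.mem_span_triple.2 ⟨x, y, 0, by simp [hA]⟩⟩
    · rw [mk_sub_le]; exact Submodule.subset_span (by simp)
    · rw [mk_sub_le]; exact Submodule.subset_span (by simp)
    · rw [mk_sub_le, hred]
      exact Submodule.sub_mem _ (Submodule.subset_span (by simp [hA]))
        (Submodule.smul_mem _ _ (Submodule.subset_span (by simp)))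

end helpers2
section helpers3

variable {K L : Type} [Field K] [Field L] [Algebra K L]

lemma bbvec_smul' (q : ℕ)
    (hnorm : ∀ γ : L, algebraMap K L (Algebra.norm K γ) = γ ^ (1 + q + q ^ 2))
    (c : L) (v : Fin 3 → L) : bbvec q K L (c • v) = Algebra.norm K c • bbvec q K L v := by
  have := hnorm c
  refine Prod.ext (Prod.ext ?_ ?_) ?_
  · simp only [bbvec, Pi.smul_apply, smul_eq_mul, Prod.smul_fst, Prod.smul_snd]
    rw [Algebra.smul_def, this]
    ring
  · simp only [bbvec, Pi.smul_apply, smul_eq_mul, Prod.smul_fst, Prod.smul_snd]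
    rw [Algebra.smul_def, this]
    ring
  · simp [bbvec]

lemma mk_rep_snd {w : (L × L) × K} (h : w ≠ 0) :
    (Projectivization.mk K w h).rep.2 ≠ 0 ↔ w.2 ≠ 0 := by
  obtain ⟨a, ha⟩ := Projectivization.exists_smul_eq_mk_rep K w h
  rw [← ha]
  simp [Units.smul_def]

lemma bb_comb (q : ℕ) [Fintype K] (hK : Fintype.card K = q)
    (hnorm : ∀ γ : L, algebraMap K L (Algebra.norm K γ) = γ ^ (1 + q + q ^ 2))
    (τ H : L) (e d N : K) (hs : algebraMap K L e + τ ≠ 0)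
    (hH : (algebraMap K L e + τ) ^ q * (algebraMap K L e + τ) ^ q ^ 2 = H)
    (hN : Algebra.norm K (algebraMap K L e + τ) = N) (x y z : K) :
    bbvec q K L (x • ![τ, 0, 0] + y • ![algebraMap K L (1 - d) * τ * (algebraMap K L e + τ)⁻¹,
      τ * (algebraMap K L e + τ)⁻¹, 0] + z • ![algebraMap K L e + algebraMap K L d * τ,
      algebraMap K L e, algebraMap K L e + τ]) =
    z ^ 2 • (z • (((algebraMap K L e + algebraMap K L d * τ) * H, algebraMap K L e * H), N)
      + x • ((τ * H, 0), (0 : K))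
      + (y / N) • ((algebraMap K L (1 - d) * τ * H ^ 2, τ * H ^ 2), (0 : K))) := by
  have hNH : algebraMap K L N = (algebraMap K L e + τ) * H := by
    rw [← hN, hnorm, ← hH]; ring
  have hH0 : H ≠ 0 := by rw [← hH]; simp [hs]
  have hzq : (algebraMap K L z) ^ q = algebraMap K L z := by
    rw [← map_pow, ← hK, FiniteField.pow_card]
  have hzq2 : (algebraMap K L z) ^ q ^ 2 = algebraMap K L z := by
    rw [pow_two, pow_mul, hzq, hzq]
  have hz3 : Algebra.norm K (algebraMap K L z) = z ^ 3 := by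
    apply (algebraMap K L).injective
    rw [hnorm, pow_add, pow_add, hzq, hzq2, map_pow]
    ring
  have h2 : (x • ![τ, 0, 0] + y • ![algebraMap K L (1 - d) * τ * (algebraMap K L e + τ)⁻¹,
      τ * (algebraMap K L e + τ)⁻¹, 0] + z • ![algebraMap K L e + algebraMap K L d * τ,
      algebraMap K L e, algebraMap K L e + τ] : Fin 3 → L) 2
      = algebraMap K L z * (algebraMap K L e + τ) := by
    simp [Algebra.smul_def]
  have hpow : (algebraMap K L z * (algebraMap K L e + τ)) ^ q *
      (algebraMap K L z * (algebraMap K L e + τ)) ^ q ^ 2 = algebraMap K L z ^ 2 * H := by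
    rw [mul_pow, mul_pow, hzq, hzq2, ← hH]; ring
  unfold bbvec
  rw [h2, hpow, map_mul, hz3, hN]
  refine Prod.ext (Prod.ext ?_ ?_) ?_
  · simp [Algebra.smul_def, hNH]
    field_simp
    ring
  · simp [Algebra.smul_def, hNH]
    field_simp
    ring
  · simp
    ring

end helpers3
/-- let B be the order-q-subplane of PG(2,q³) with points T = (1:0:0),
P_{e,d} = (e+dτ : e : e+τ) and U_f = (1+fτ : 1 : 1), tangent to ℓ∞ at T. Fix e,d and let
P = P_{e,d}; let m be the order-q-subline of ℓ∞ cut out by the lines of PG(2,q³) through P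
containing at least two points of B, and let P^⊥ be the unique order-q-subplane containing m
and B ∩ TP. Then the Bruck–Bose images of the points of P^⊥ ∖ ℓ∞ are exactly the points with
nonzero last coordinate of the plane of ℙ_K(L×L×K) spanned by
((e+dτ)θ⁻(e), eθ⁻(e), θ(e)), (τθ⁻(e), 0, 0) and ((1−d)τθ⁻(e)², τθ⁻(e)², 0). -/
theorem tangent_splash_stmt_10
    (q : ℕ) (K L : Type) [Field K] [Field L] [Algebra K L] [Fintype K]
    (hK : Fintype.card K = q)
    (τ : L) (t₀ t₁ t₂ : K)
    (B : Basis (Fin 3) K L) (hB0 : B 0 = 1) (hB1 : B 1 = τ) (hB2 : B 2 = τ ^ 2)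
    (hτ3 : τ ^ 3 = algebraMap K L t₂ * τ ^ 2 + algebraMap K L t₁ * τ + algebraMap K L t₀)
    (hprim : ∀ x : L, x ≠ 0 → ∃ n : ℕ, τ ^ n = x)
    (hnorm : ∀ γ : L, algebraMap K L (Algebra.norm K γ) = γ ^ (1 + q + q ^ 2))
    -- the subplane B
    (Bs : Set (ℙ L (Fin 3 → L)))
    (hBs : Bs = {X : ℙ L (Fin 3 → L) |
      (∃ h : (![1, 0, 0] : Fin 3 → L) ≠ 0, X = Projectivization.mk L ![1, 0, 0] h) ∨
      (∃ e' d' : K, ∃ h : (![algebraMap K L e' + algebraMap K L d' * τ, algebraMap K L e',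
          algebraMap K L e' + τ] : Fin 3 → L) ≠ 0,
        X = Projectivization.mk L ![algebraMap K L e' + algebraMap K L d' * τ,
          algebraMap K L e', algebraMap K L e' + τ] h) ∨
      (∃ f : K, ∃ h : (![1 + algebraMap K L f * τ, 1, 1] : Fin 3 → L) ≠ 0,
        X = Projectivization.mk L ![1 + algebraMap K L f * τ, 1, 1] h)})
    -- the point T = (1:0:0)
    (T : ℙ L (Fin 3 → L)) (hT0 : (![1, 0, 0] : Fin 3 → L) ≠ 0)
    (hT : T = Projectivization.mk L ![1, 0, 0] hT0)
    -- the fixed point P = P_{e,d}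
    (e d : K)
    (Pv : Fin 3 → L)
    (hPv : Pv = ![algebraMap K L e + algebraMap K L d * τ, algebraMap K L e,
      algebraMap K L e + τ])
    (hPv0 : Pv ≠ 0)
    (P : ℙ L (Fin 3 → L)) (hP : P = Projectivization.mk L Pv hPv0)
    -- m = {n ∩ ℓ∞ : n a line of PG(2,q³) containing P and at least two points of B}
    (m : Set (ℙ L (Fin 3 → L)))
    (hm : m = {X : ℙ L (Fin 3 → L) | X ∈ linfty L ∧
      ∃ n : Submodule L (Fin 3 → L), Module.finrank L n = 2 ∧ P.submodule ≤ n ∧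
        (∃ A₁ ∈ Bs, ∃ A₂ ∈ Bs, A₁ ≠ A₂ ∧ A₁.submodule ≤ n ∧ A₂.submodule ≤ n) ∧
        X.submodule ≤ n}) :
    -- B is an order-q-subplane tangent to ℓ∞ at T
    IsOSubplane K L Bs ∧ Bs ∩ linfty L = {T} ∧
    -- m is an order-q-subline of ℓ∞ through T
    IsOSubline K L m ∧ m ⊆ linfty L ∧ T ∈ m ∧
    -- P^⊥ : the unique order-q-subplane containing m and B ∩ TP exists
    (∃! C : Set (ℙ L (Fin 3 → L)), IsOSubplane K L C ∧ m ⊆ C ∧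
      (Bs ∩ {X : ℙ L (Fin 3 → L) | X.submodule ≤ T.submodule ⊔ P.submodule}) ⊆ C) ∧
    -- the claimed span is indeed a plane of ℙ_K(L×L×K)
    Module.finrank K ↥(Submodule.span K
      ({(((algebraMap K L e + algebraMap K L d * τ) *
            ((algebraMap K L e + τ ^ q) * (algebraMap K L e + τ ^ q ^ 2)),
          algebraMap K L e * ((algebraMap K L e + τ ^ q) * (algebraMap K L e + τ ^ q ^ 2))),
          Algebra.norm K (algebraMap K L e + τ)),
        ((τ * ((algebraMap K L e + τ ^ q) * (algebraMap K L e + τ ^ q ^ 2)), 0), (0 : K)),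
        ((algebraMap K L (1 - d) * τ *
            ((algebraMap K L e + τ ^ q) * (algebraMap K L e + τ ^ q ^ 2)) ^ 2,
          τ * ((algebraMap K L e + τ ^ q) * (algebraMap K L e + τ ^ q ^ 2)) ^ 2), (0 : K))} :
        Set ((L × L) × K))) = 3 ∧
    -- and for P^⊥, the set of Bruck–Bose images of the points of P^⊥ ∖ ℓ∞ is exactly the
    -- set of points of this plane having nonzero last coordinate
    (∀ C : Set (ℙ L (Fin 3 → L)),
      (IsOSubplane K L C ∧ m ⊆ C ∧
        (Bs ∩ {X : ℙ L (Fin 3 → L) | X.submodule ≤ T.submodule ⊔ P.submodule}) ⊆ C) →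
      {Q : ℙ K ((L × L) × K) | ∃ X ∈ C, X ∉ linfty L ∧
          ∃ (v : Fin 3 → L) (hv : v ≠ 0), X = Projectivization.mk L v hv ∧
            ∃ hw : bbvec q K L v ≠ 0, Q = Projectivization.mk K (bbvec q K L v) hw} =
        {Q : ℙ K ((L × L) × K) | Q.submodule ≤ Submodule.span K
            ({(((algebraMap K L e + algebraMap K L d * τ) *
                  ((algebraMap K L e + τ ^ q) * (algebraMap K L e + τ ^ q ^ 2)),
                algebraMap K L e *
                  ((algebraMap K L e + τ ^ q) * (algebraMap K L e + τ ^ q ^ 2))),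
                Algebra.norm K (algebraMap K L e + τ)),
              ((τ * ((algebraMap K L e + τ ^ q) * (algebraMap K L e + τ ^ q ^ 2)), 0),
                (0 : K)),
              ((algebraMap K L (1 - d) * τ *
                  ((algebraMap K L e + τ ^ q) * (algebraMap K L e + τ ^ q ^ 2)) ^ 2,
                τ * ((algebraMap K L e + τ ^ q) * (algebraMap K L e + τ ^ q ^ 2)) ^ 2),
                (0 : K))} : Set ((L × L) × K)) ∧
          Q.rep.2 ≠ 0}) := by
  have hτ : ∀ x y : K, algebraMap K L x + algebraMap K L y * τ = 0 → x = 0 ∧ y = 0 := by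
    intro x y h
    have hli := Fintype.linearIndependent_iff.1 B.linearIndependent ![x, y, 0] (by
      simp [Fin.sum_univ_three, hB0, hB1, Algebra.smul_def, h])
    exact ⟨hli 0, hli 1⟩
  have t0 : τ ≠ 0 := by rintro rfl; simpa using hτ 0 1
  have s0 : algebraMap K L e + τ ≠ 0 := by
    intro h; simpa using hτ e 1 (by simpa using h)
  rw [Bs_eq τ hτ] at hBs
  rw [hP, m_eq τ hτ e d Pv hPv hPv0 Bs hBs] at hm
  have hTτ : ∀ h : (![τ, 0, 0] : Fin 3 → L) ≠ 0, Projectivization.mk L ![τ, 0, 0] h = T := by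
    intro h
    rw [hT, Projectivization.mk_eq_mk_iff']
    exact ⟨τ, by ext i; fin_cases i <;> simp⟩
  have w0 : (![τ, 0, 0] : Fin 3 → L) ≠ 0 := fun h => t0 (by simpa using congrFun h 0)
  have hPe : Pv = d • ![τ, 0, 0] + e • ![1, 1, 1] + (1 : K) • ![0, 0, τ] := by
    rw [hPv]; ext i; fin_cases i <;> simp [Algebra.smul_def, add_comm]
  have hLI : LI3 ![τ, 0, 0] ![algebraMap K L (1 - d) * τ * (algebraMap K L e + τ)⁻¹,
      τ * (algebraMap K L e + τ)⁻¹, 0] Pv := by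
    rw [hPv]
    exact li_U t0 (by simp [t0, s0]) s0
  have hTm : T ∈ m := by
    rw [← hTτ w0, hm, mem_PS]
    exact ⟨1, one_ne_zero, by rw [one_smul]; exact Submodule.subset_span (by simp)⟩
  -- membership in B ∩ TP
  have hline : ∀ X ∈ Bs, X.submodule ≤ T.submodule ⊔ P.submodule →
      X ∈ PS (Submodule.span K {![τ, 0, 0], ![algebraMap K L (1 - d) * τ *
        (algebraMap K L e + τ)⁻¹, τ * (algebraMap K L e + τ)⁻¹, 0], Pv}) := by
    intro X hX hXl
    rw [hBs] at hX
    obtain ⟨v, hv, hv0, rfl⟩ := hX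
    obtain ⟨x, y, z, rfl⟩ := Submodule.mem_span_triple.1 hv
    rw [mk_sub_le, hP, ← hTτ w0, Projectivization.submodule_mk, Projectivization.submodule_mk,
      ← Submodule.span_insert, Submodule.mem_span_pair] at hXl
    obtain ⟨α, β, hh⟩ := hXl
    have hq := li_B τ t0 (α + β * algebraMap K L d - algebraMap K L x)
      (β * algebraMap K L e - algebraMap K L y) (β - algebraMap K L z) (by
        rw [hPe, ← sub_eq_zero] at hh
        rw [← hh]
        generalize (![τ, 0, 0] : Fin 3 → L) = W1
        generalize (![1, 1, 1] : Fin 3 → L) = W2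
        generalize (![0, 0, τ] : Fin 3 → L) = W3
        ext i
        simp [Algebra.smul_def]
        ring)
    have hβ : β = algebraMap K L z := by linear_combination hq.2.2
    have hy : y = z * e := by
      apply (algebraMap K L).injective
      rw [map_mul, ← hβ]
      linear_combination -hq.2.1
    rw [mem_PS]
    refine ⟨1, one_ne_zero, ?_⟩
    rw [one_smul, Submodule.mem_span_triple]
    refine ⟨x - z * d, 0, z, ?_⟩
    rw [hPe, hy]
    module
  have hPS : IsOSubplane K L (PS (Submodule.span K {![τ, 0, 0], ![algebraMap K L (1 - d) * τ *
        (algebraMap K L e + τ)⁻¹, τ * (algebraMap K L e + τ)⁻¹, 0], Pv})) ∧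
      m ⊆ PS (Submodule.span K {![τ, 0, 0], ![algebraMap K L (1 - d) * τ *
        (algebraMap K L e + τ)⁻¹, τ * (algebraMap K L e + τ)⁻¹, 0], Pv}) ∧
      (Bs ∩ {X : ℙ L (Fin 3 → L) | X.submodule ≤ T.submodule ⊔ P.submodule}) ⊆
        PS (Submodule.span K {![τ, 0, 0], ![algebraMap K L (1 - d) * τ *
        (algebraMap K L e + τ)⁻¹, τ * (algebraMap K L e + τ)⁻¹, 0], Pv}) := by
    refine ⟨hLI.sub, ?_, fun X hX => hline X hX.1 hX.2⟩
    rw [hm]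
    rintro X ⟨v, hv, hv0, rfl⟩
    refine ⟨v, Submodule.span_mono ?_ hv, hv0, rfl⟩
    intro x hx
    rcases hx with rfl | rfl <;> simp
  have huniq : ∀ C : Set (ℙ L (Fin 3 → L)), (IsOSubplane K L C ∧ m ⊆ C ∧
      (Bs ∩ {X : ℙ L (Fin 3 → L) | X.submodule ≤ T.submodule ⊔ P.submodule}) ⊆ C) →
      C = PS (Submodule.span K {![τ, 0, 0], ![algebraMap K L (1 - d) * τ *
        (algebraMap K L e + τ)⁻¹, τ * (algebraMap K L e + τ)⁻¹, 0], Pv}) := by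
    rintro C ⟨hC, hmC, hBC⟩
    refine PS_unique hLI hC ?_ ?_ ?_ ?_ ?_
    · intro h
      rw [hTτ]
      exact hmC hTm
    · intro h
      apply hmC
      rw [hm, mem_PS]
      exact ⟨1, one_ne_zero, by rw [one_smul]; exact Submodule.subset_span (by simp)⟩
    · intro h
      refine hBC ⟨?_, ?_⟩
      · rw [hBs, mem_PS]
        refine ⟨1, one_ne_zero, ?_⟩
        rw [one_smul]
        exact Submodule.mem_span_triple.2 ⟨d, e, 1, hPe.symm⟩
      · rw [Set.mem_ofPred_eq]
        rw [mk_sub_le, hP, Projectivization.submodule_mk Pv hPv0]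
        exact Submodule.mem_sup_right (Submodule.mem_span_singleton_self _)
    · intro h
      apply hmC
      rw [hm, mem_PS]
      refine ⟨1, one_ne_zero, ?_⟩
      rw [one_smul]
      exact Submodule.mem_span_pair.2 ⟨1, 1, by rw [one_smul, one_smul]⟩
    · intro h
      refine hBC ⟨?_, ?_⟩
      · rw [hBs, mem_PS]
        refine ⟨1, one_ne_zero, ?_⟩
        rw [one_smul]
        exact Submodule.mem_span_triple.2 ⟨d + 1, e, 1, by rw [hPe]; module⟩
      · rw [Set.mem_ofPred_eq]
        rw [mk_sub_le, hP, ← hTτ w0, Projectivization.submodule_mk, Projectivization.submodule_mk]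
        exact Submodule.add_mem_sup (Submodule.mem_span_singleton_self _)
          (Submodule.mem_span_singleton_self _)
  -- Frobenius and norm
  have hfr : ∀ x : L, (algebraMap K L e + x) ^ q = algebraMap K L e + x ^ q := by
    intro x
    have := map_add (FiniteField.frobeniusAlgHom K L) (algebraMap K L e) x
    rw [AlgHom.commutes] at this
    simpa [hK] using this
  have hfr2 : (algebraMap K L e + τ) ^ q ^ 2 = algebraMap K L e + τ ^ q ^ 2 := by
    rw [pow_two, pow_mul, hfr, hfr, ← pow_mul]
  have hH : (algebraMap K L e + τ) ^ q * (algebraMap K L e + τ) ^ q ^ 2 =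
      (algebraMap K L e + τ ^ q) * (algebraMap K L e + τ ^ q ^ 2) := by rw [hfr, hfr2]
  have hN0 : Algebra.norm K (algebraMap K L e + τ) ≠ 0 := by
    intro h
    have := hnorm (algebraMap K L e + τ)
    rw [h, map_zero] at this
    exact pow_ne_zero _ s0 this.symm
  have hbb := bb_comb q hK hnorm τ _ e d _ s0 hH rfl
  have hH0 : (algebraMap K L e + τ ^ q) * (algebraMap K L e + τ ^ q ^ 2) ≠ 0 := by
    rw [← hH]; simp [s0]
  clear hH hfr hfr2
  generalize (algebraMap K L e + τ ^ q) * (algebraMap K L e + τ ^ q ^ 2) = H at *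
  rw [← hPv] at hbb
  generalize hNN : Algebra.norm K (algebraMap K L e + τ) = N at *
  refine ⟨?_, ?_, ?_, ?_, hTm, ⟨_, hPS, huniq⟩, ?_, ?_⟩
  · rw [hBs]; exact (li_B τ t0).sub
  · apply Set.Subset.antisymm
    · rintro X ⟨hX, hXi⟩
      rw [hBs] at hX
      obtain ⟨v, hv, hv0, rfl⟩ := hX
      obtain ⟨x, y, z, rfl⟩ := Submodule.mem_span_triple.1 hv
      rw [mk_mem_linfty] at hXi
      have hyz := hτ y z (by simpa [Algebra.smul_def] using hXi)
      rw [Set.mem_singleton_iff, hT, Projectivization.mk_eq_mk_iff']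
      refine ⟨algebraMap K L x * τ, ?_⟩
      ext i; fin_cases i <;> simp [hyz, Algebra.smul_def]
    · rintro X rfl
      refine ⟨?_, ?_⟩
      · rw [← hTτ w0, hBs, mem_PS]
        exact ⟨1, one_ne_zero, by rw [one_smul]; exact Submodule.subset_span (by simp)⟩
      · rw [hT, mk_mem_linfty]; rfl
  · rw [hm]; exact hLI.subline
  · rw [hm]
    rintro X ⟨v, hv, hv0, rfl⟩
    obtain ⟨x, y, rfl⟩ := Submodule.mem_span_pair.1 hv
    rw [mk_mem_linfty]
    simp
  · have hli : LinearIndependent K ![(((algebraMap K L e + algebraMap K L d * τ) * H,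
        algebraMap K L e * H), N), ((τ * H, 0), (0 : K)),
        ((algebraMap K L (1 - d) * τ * H ^ 2, τ * H ^ 2), (0 : K))] := by
      rw [Fintype.linearIndependent_iff]
      intro g hg
      have h2 : g 0 = 0 := by
        have := congrArg Prod.snd hg
        simpa [Fin.sum_univ_three, hN0] using this
      have h1 : g 2 = 0 := by
        have := congrArg (fun w => w.1.2) hg
        simpa [Fin.sum_univ_three, h2, Algebra.smul_def, t0, hH0] using this
      have h0 : g 1 = 0 := by
        have := congrArg (fun w => w.1.1) hg
        simpa [Fin.sum_univ_three, h1, h2, Algebra.smul_def, t0, hH0] using this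
      intro i
      fin_cases i
      · exact h2
      · exact h0
      · exact h1
    have hc := finrank_span_eq_card hli
    have hr : ∀ a b c : (L × L) × K, Set.range ![a, b, c] = {a, b, c} := by
      intro a b c
      ext x
      simp [eq_comm]
      tauto
    rw [hr] at hc
    simpa using hc
  · intro C hC
    rw [huniq C hC]
    ext Q
    constructor
    · rintro ⟨X, hX, hXi, v, hv, rfl, hw, rfl⟩
      obtain ⟨v', hv', hv0', he⟩ := hX
      obtain ⟨c, rfl⟩ := (Projectivization.mk_eq_mk_iff' L _ _ _ _).1 he
      obtain ⟨x, y, z, rfl⟩ := Submodule.mem_span_triple.1 hv'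
      rw [mk_mem_linfty] at hXi
      refine ⟨?_, ?_⟩
      · rw [mk_sub_le, bbvec_smul' q hnorm, hbb]
        apply Submodule.smul_mem
        apply Submodule.smul_mem
        exact Submodule.mem_span_triple.2 ⟨_, _, _, rfl⟩
      · rw [mk_rep_snd]
        intro h
        have h4 := hnorm ((c • (x • ![τ, 0, 0] + y • ![algebraMap K L (1 - d) * τ *
          (algebraMap K L e + τ)⁻¹, τ * (algebraMap K L e + τ)⁻¹, 0] + z • Pv)) 2)
        have h5 : Algebra.norm K ((c • (x • ![τ, 0, 0] + y • ![algebraMap K L (1 - d) * τ *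
          (algebraMap K L e + τ)⁻¹, τ * (algebraMap K L e + τ)⁻¹, 0] + z • Pv)) 2) = 0 := h
        rw [h5, map_zero] at h4
        exact pow_ne_zero _ hXi h4.symm
    · induction Q using Projectivization.ind with
      | h w hw =>
        rintro ⟨hQ, hQ2⟩
        rw [mk_sub_le] at hQ
        rw [mk_rep_snd] at hQ2
        obtain ⟨z, x, y, rfl⟩ := Submodule.mem_span_triple.1 hQ
        have hz : z ≠ 0 := by
          rintro rfl
          simp at hQ2
        have hb := hbb x (y * N) z
        rw [mul_div_cancel_right₀ _ hN0] at hb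
        have hv2 : (x • ![τ, 0, 0] + (y * N) • ![algebraMap K L (1 - d) * τ *
            (algebraMap K L e + τ)⁻¹, τ * (algebraMap K L e + τ)⁻¹, 0] + z • Pv) 2 ≠ 0 := by
          rw [hPv]
          simp [Algebra.smul_def, hz, s0]
        have hv0 : x • ![τ, 0, 0] + (y * N) • ![algebraMap K L (1 - d) * τ *
            (algebraMap K L e + τ)⁻¹, τ * (algebraMap K L e + τ)⁻¹, 0] + z • Pv ≠ 0 := by
          intro h
          rw [h] at hv2
          exact hv2 rfl
        have hb0 := smul_ne_zero (pow_ne_zero 2 hz) hw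
        refine ⟨Projectivization.mk L _ hv0, ⟨_, Submodule.mem_span_triple.2 ⟨x, y * N, z, rfl⟩,
          hv0, rfl⟩, ?_, _, hv0, rfl, ?_, ?_⟩
        · rw [mk_mem_linfty]; exact hv2
        · rw [hb]; exact hb0
        · rw [Projectivization.mk_eq_mk_iff']
          refine ⟨(z ^ 2)⁻¹, ?_⟩
          rw [hb, smul_smul, inv_mul_cancel₀ (pow_ne_zero 2 hz), one_smul]

end
end

section
/- Let Θ be the projective transformation of ℙ_K(L) induced by the K-linear map x ↦ τx, and let C̄ := {[θ⁻(e)τ] : e ∈ K} ∪ {[τ]} ⊆ ℙ_K(L). Then for every integer i ≥ 0, Θ^i(C̄) = C̄ if and only if q²+q+1 divides i. In particular, the orbit of the set C̄ under the cyclic group ⟨Θ⟩ has size exactly q²+q+1. -/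
open scoped LinearAlgebra.Projectivization
open Module

/-- with Θ the projective transformation of ℙ_K(L) induced by x ↦ τx and
C̄ := {[θ⁻(e)τ] : e ∈ K} ∪ {[τ]}, for every i ≥ 0 we have Θ^i(C̄) = C̄ iff q²+q+1 ∣ i; in
particular the orbit of C̄ under ⟨Θ⟩ has size exactly q²+q+1. -/
theorem tangent_splash_stmt_13
    (q : ℕ) (K L : Type) [Field K] [Field L] [Algebra K L] [Fintype K]
    (hK : Fintype.card K = q)
    (τ : L) (t₀ t₁ t₂ : K)
    (B : Basis (Fin 3) K L) (hB0 : B 0 = 1) (hB1 : B 1 = τ) (hB2 : B 2 = τ ^ 2)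
    (hτ3 : τ ^ 3 = algebraMap K L t₂ * τ ^ 2 + algebraMap K L t₁ * τ + algebraMap K L t₀)
    (hprim : ∀ x : L, x ≠ 0 → ∃ n : ℕ, τ ^ n = x)
    (hinj : Function.Injective (⇑(LinearMap.mulLeft K τ)))
    -- the vectors representing the points C_e (e ∈ K) and C_∞ (index `none`)
    (Cvec : Option K → L)
    (hCe : ∀ e : K, Cvec (some e) =
      (algebraMap K L e + τ ^ q) * (algebraMap K L e + τ ^ q ^ 2) * τ)
    (hCinf : Cvec none = τ)
    (hC0 : ∀ i : Option K, Cvec i ≠ 0) :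
    (∀ i : ℕ,
      (Projectivization.map (LinearMap.mulLeft K τ) hinj)^[i] ''
          Set.range (fun j : Option K => Projectivization.mk K (Cvec j) (hC0 j)) =
        Set.range (fun j : Option K => Projectivization.mk K (Cvec j) (hC0 j)) ↔
      (q ^ 2 + q + 1) ∣ i) ∧
    Set.ncard {S : Set (ℙ K L) | ∃ i : ℕ,
      S = (Projectivization.map (LinearMap.mulLeft K τ) hinj)^[i] ''
        Set.range (fun j : Option K => Projectivization.mk K (Cvec j) (hC0 j))} =
      q ^ 2 + q + 1 := by
  subst hK
  classical
  have hfin : Module.Finite K L := Module.Finite.of_basis B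
  have hrank : finrank K L = 3 := by rw [finrank_eq_card_basis B]; simp
  have : Finite L := Module.finite_of_finite K
  have : Fintype L := Fintype.ofFinite L
  set q := Fintype.card K with hq
  have hq1 : 1 < q := Fintype.one_lt_card
  have hcard : Fintype.card L = q ^ 3 := by
    rw [Module.card_eq_pow_finrank (K := K), hrank]
  have hτ0 : τ ≠ 0 := by rw [← hB1]; exact B.ne_zero 1
  have hfrob : ∀ (e : K) (x : L), (algebraMap K L e + x) ^ q = algebraMap K L e + x ^ q := by
    intro e x
    have := map_add (FiniteField.frobeniusAlgHom K L) (algebraMap K L e) x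
    rw [AlgHom.commutes] at this
    simpa using this
  have hnorm : ∀ x : L, algebraMap K L (Algebra.norm K x) = x * x ^ q * x ^ q ^ 2 := by
    intro x
    rw [FiniteField.algebraMap_norm_eq_prod_pow, hrank, Nat.card_eq_fintype_card, ← hq]
    simp [Finset.prod_range_succ]
  have hord : orderOf τ = q ^ 3 - 1 := by
    have h1 : orderOf (Units.mk0 τ hτ0) = Nat.card Lˣ := by
      apply orderOf_eq_card_of_forall_mem_zpowers
      intro x
      obtain ⟨n, hn⟩ := hprim x x.ne_zero
      exact ⟨n, by ext; simpa using hn⟩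
    rw [← orderOf_units, Units.val_mk0] at h1
    rw [h1, Nat.card_units, Nat.card_eq_fintype_card, hcard]
  have hfac : q ^ 3 - 1 = (q ^ 2 + q + 1) * (q - 1) := by
    obtain ⟨m, hm⟩ : ∃ m, q = m + 1 := ⟨q - 1, by omega⟩
    rw [hm]
    simp only [Nat.add_sub_cancel]
    rw [Nat.sub_eq_iff_eq_add (Nat.one_le_pow _ _ (by omega))]
    ring
  -- powers of `τ` lying in `K`
  have hpowK : ∀ (i : ℕ) (a : K), τ ^ i = algebraMap K L a → (q ^ 2 + q + 1) ∣ i := by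
    intro i a h
    have ha : a ≠ 0 := by
      rintro rfl
      exact pow_ne_zero i hτ0 (by simpa using h)
    have h1 : τ ^ (i * (q - 1)) = 1 := by
      rw [pow_mul, h, ← map_pow, FiniteField.pow_card_sub_one_eq_one a ha, map_one]
    have h2 := orderOf_dvd_of_pow_eq_one h1
    rw [hord, hfac] at h2
    exact Nat.dvd_of_mul_dvd_mul_right (by omega) h2
  have hNK : ∃ n : K, n ≠ 0 ∧ τ ^ (q ^ 2 + q + 1) = algebraMap K L n := by
    refine ⟨Algebra.norm K τ, by simpa [Algebra.norm_eq_zero_iff] using hτ0, ?_⟩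
    rw [hnorm]; ring
  have hindep : ∀ a b c : K, algebraMap K L a + algebraMap K L b * τ + algebraMap K L c * τ ^ 2 = 0 →
      c = 0 := by
    intro a b c h
    have := Fintype.linearIndependent_iff.1 B.linearIndependent ![a, b, c]
      (by simpa [Fin.sum_univ_three, hB0, hB1, hB2, Algebra.smul_def] using h) 2
    simpa using this
  -- uniform description of the points
  have hV : ∀ j : Option K, ∃ a b k : K, k ≠ 0 ∧
      Cvec j * (algebraMap K L a + algebraMap K L b * τ) = algebraMap K L k * τ := by
    intro j
    cases j with
    | none => exact ⟨1, 0, 1, one_ne_zero, by simp [hCinf]⟩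
    | some e =>
      have hne : algebraMap K L e + τ ≠ 0 := by
        intro h
        have := Fintype.linearIndependent_iff.1 B.linearIndependent ![e, 1, 0]
          (by simpa [Fin.sum_univ_three, hB0, hB1, hB2, Algebra.smul_def] using h) 1
        simp at this
      refine ⟨e, 1, Algebra.norm K (algebraMap K L e + τ), by
        simpa [Algebra.norm_eq_zero_iff] using hne, ?_⟩
      rw [hnorm, hCe, pow_two, pow_mul, pow_mul, hfrob, hfrob, map_one]
      ring
  set Θ := Projectivization.map (LinearMap.mulLeft K τ) hinj with hΘ
  set C := Set.range (fun j : Option K => Projectivization.mk K (Cvec j) (hC0 j)) with hC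
  have hiter : ∀ (i : ℕ) (v : L) (hv : v ≠ 0), Θ^[i] (Projectivization.mk K v hv) =
      Projectivization.mk K (τ ^ i * v) (mul_ne_zero (pow_ne_zero i hτ0) hv) := by
    intro i
    induction i with
    | zero => intro v hv; simp
    | succ n ih =>
      intro v hv
      rw [Function.iterate_succ_apply', ih, hΘ, Projectivization.map_mk]
      simp only [LinearMap.mulLeft_apply, pow_succ', mul_assoc]
  have main : ∀ i : ℕ, Θ^[i] '' C = C ↔ (q ^ 2 + q + 1) ∣ i := by
    intro i
    constructor
    · intro h
      have key : ∀ j : Option K, ∃ (j' : Option K) (c : K), c ≠ 0 ∧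
          algebraMap K L c * Cvec j' = τ ^ i * Cvec j := by
        intro j
        have h1 : Θ^[i] (Projectivization.mk K (Cvec j) (hC0 j)) ∈ C := by
          rw [← h]; exact ⟨_, ⟨j, rfl⟩, rfl⟩
        obtain ⟨j', hj'⟩ := h1
        simp only [hiter] at hj'
        obtain ⟨c, hc⟩ := (Projectivization.mk_eq_mk_iff K _ _ _ _).1 hj'.symm
        exact ⟨j', c, c.ne_zero, by rw [← hc, Units.smul_def, Algebra.smul_def]⟩
      obtain ⟨j, c, hc, h1⟩ := key none
      obtain ⟨j', c', hc', h2⟩ := key (some 0)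
      obtain ⟨a, b, k, hk, h3⟩ := hV j
      obtain ⟨a', b', k', hk', h4⟩ := hV j'
      have hs := hnorm τ
      have hn0 : Algebra.norm K τ ≠ 0 := by simpa [Algebra.norm_eq_zero_iff] using hτ0
      set n := Algebra.norm K τ
      have hCzero : Cvec (some 0) = algebraMap K L n := by
        rw [hs, hCe]; simp only [map_zero, zero_add]; ring
      rw [hCinf] at h1
      rw [hCzero] at h2
      -- `τ^i (a + bτ) = c k`
      have h5 : τ ^ i * (algebraMap K L a + algebraMap K L b * τ) = algebraMap K L (c * k) := by
        apply mul_right_cancel₀ hτ0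
        rw [map_mul]
        linear_combination (-(algebraMap K L a + algebraMap K L b * τ)) * h1 + algebraMap K L c * h3
      have h6 : τ ^ i * algebraMap K L n * (algebraMap K L a' + algebraMap K L b' * τ) =
          algebraMap K L (c' * k') * τ := by
        rw [map_mul]
        linear_combination (-(algebraMap K L a' + algebraMap K L b' * τ)) * h2 +
          algebraMap K L c' * h4
      have h7 : algebraMap K L (c * k * n) * (algebraMap K L a' + algebraMap K L b' * τ) =
          algebraMap K L (c' * k') * τ * (algebraMap K L a + algebraMap K L b * τ) := by
        rw [map_mul _ (c * k), ← h5]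
        linear_combination (algebraMap K L a + algebraMap K L b * τ) * h6
      have h8 : c' * k' * b = 0 := by
        apply hindep (-(c * k * n * a')) (c' * k' * a - c * k * n * b')
        simp only [map_mul, map_sub, map_neg] at h7 ⊢
        linear_combination -h7
      have hb : b = 0 := by simpa [hc', hk'] using h8
      subst hb
      have ha : a ≠ 0 := by
        rintro rfl
        have : c * k = 0 := by
          apply (algebraMap K L).injective
          rw [← h5]; simp
        simp [hc, hk] at this
      apply hpowK i (c * k / a)
      rw [map_div₀, eq_div_iff (by simpa using ha), ← h5]
      simp
    · rintro ⟨m, rfl⟩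
      obtain ⟨n, hn, hN⟩ := hNK
      have hid : ∀ p, Θ^[(q ^ 2 + q + 1) * m] p = p := by
        intro p
        induction p using Projectivization.ind with
        | h v hv =>
          rw [hiter, Projectivization.mk_eq_mk_iff]
          refine ⟨Units.mk0 (n ^ m) (pow_ne_zero m hn), ?_⟩
          rw [Units.smul_def, Algebra.smul_def, Units.val_mk0, pow_mul, hN, map_pow]
      have : Θ^[(q ^ 2 + q + 1) * m] = id := funext hid
      rw [this, Set.image_id]
  refine ⟨main, ?_⟩
  have hper : ∀ i, Function.IsPeriodicPt (Set.image Θ) i C ↔ (q ^ 2 + q + 1) ∣ i := by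
    intro i
    rw [← main i, Function.IsPeriodicPt, Function.IsFixedPt, Set.image_iterate_eq]
  have hmin : Function.minimalPeriod (Set.image Θ) C = q ^ 2 + q + 1 := by
    apply Nat.dvd_antisymm
    · exact ((hper _).2 dvd_rfl).minimalPeriod_dvd
    · exact (hper _).1 (Function.isPeriodicPt_minimalPeriod _ _)
  have hset : {S : Set (ℙ K L) | ∃ i : ℕ, S = Θ^[i] '' C} =
      (fun i => (Set.image Θ)^[i] C) '' Set.Iio (q ^ 2 + q + 1) := by
    ext S
    constructor
    · rintro ⟨i, rfl⟩
      refine ⟨i % (q ^ 2 + q + 1), Nat.mod_lt _ (by omega), ?_⟩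
      simp only
      rw [← hmin, Function.iterate_mod_minimalPeriod_eq, Set.image_iterate_eq]
    · rintro ⟨i, -, rfl⟩
      exact ⟨i, by simp only [Set.image_iterate_eq]⟩
  rw [hset, Set.ncard_image_of_injOn]
  · rw [← Finset.coe_Iio, Set.ncard_coe_finset, Nat.card_Iio]
  · rw [← hmin]
    exact Function.iterate_injOn_Iio_minimalPeriod
end

section
/- Let Θ be the projective transformation of ℙ_K(L) induced by the K-linear map x ↦ τx, and let D̄ := {[θ⁻(e)²τ] : e ∈ K} ∪ {[τ]} ⊆ ℙ_K(L). Then for every integer i ≥ 0, Θ^i(D̄) = D̄ if and only if q²+q+1 divides i. In particular, the orbit of the set D̄ under the cyclic group ⟨Θ⟩ has size exactly q²+q+1. -/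
open scoped LinearAlgebra.Projectivization
open Module

lemma aux_mem_base {K L : Type} [Field K] [Field L] [Algebra K L] [Fintype K] (x : L)
    (hx : x ^ Fintype.card K = x) : ∃ k : K, algebraMap K L k = x := by
  classical
  have h1 : 1 < Fintype.card K := Fintype.one_lt_card
  have hne : (Polynomial.X ^ Fintype.card K - Polynomial.X : Polynomial L) ≠ 0 :=
    FiniteField.X_pow_card_sub_X_ne_zero L h1
  have hdeg := FiniteField.X_pow_card_sub_X_natDegree_eq L h1
  have hsub : Finset.univ.image (algebraMap K L) ⊆
      (Polynomial.X ^ Fintype.card K - Polynomial.X : Polynomial L).roots.toFinset := by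
    intro y hy
    obtain ⟨k, -, rfl⟩ := Finset.mem_image.1 hy
    rw [Multiset.mem_toFinset, Polynomial.mem_roots hne, Polynomial.IsRoot.def]
    simp only [Polynomial.eval_sub, Polynomial.eval_pow, Polynomial.eval_X]
    rw [← map_pow, FiniteField.pow_card, sub_self]
  have hcard : (Polynomial.X ^ Fintype.card K - Polynomial.X : Polynomial L).roots.toFinset.card ≤
      (Finset.univ.image (algebraMap K L)).card := by
    rw [Finset.card_image_of_injective _ (algebraMap K L).injective, Finset.card_univ]
    calc _ ≤ _ := Multiset.toFinset_card_le _
      _ ≤ _ := Polynomial.card_roots' _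
      _ = _ := hdeg
  have heq := Finset.eq_of_subset_of_card_le hsub hcard
  have hmem : x ∈ Finset.univ.image (algebraMap K L) := by
    rw [heq, Multiset.mem_toFinset, Polynomial.mem_roots hne, Polynomial.IsRoot.def]
    simp [hx]
  obtain ⟨k, -, hk⟩ := Finset.mem_image.1 hmem
  exact ⟨k, hk⟩

lemma aux_iter {K L : Type} [Field K] [Field L] [Algebra K L] (τ : L) (h0 : τ ≠ 0)
    (hinj : Function.Injective (⇑(LinearMap.mulLeft K τ))) (i : ℕ) (v : L) (hv : v ≠ 0) :
    (Projectivization.map (LinearMap.mulLeft K τ) hinj)^[i] (Projectivization.mk K v hv) =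
      Projectivization.mk K (τ ^ i * v) (mul_ne_zero (pow_ne_zero _ h0) hv) := by
  induction i with
  | zero => simp
  | succ n ih =>
    rw [Function.iterate_succ_apply', ih, Projectivization.map_mk]
    congr 1
    simp only [LinearMap.mulLeft_apply]
    ring

lemma aux_order {L : Type} [Field L] [Finite L] (τ : L) (h0 : τ ≠ 0)
    (hprim : ∀ x : L, x ≠ 0 → ∃ n : ℕ, τ ^ n = x) (m : ℕ) (hm : τ ^ m = 1) :
    Nat.card L - 1 ∣ m := by
  have h : orderOf (Units.mk0 τ h0) = Nat.card Lˣ := by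
    apply orderOf_eq_card_of_forall_mem_powers
    intro x
    obtain ⟨n, hn⟩ := hprim x x.ne_zero
    exact ⟨n, by ext; simpa using hn⟩
  rw [← Nat.card_units, ← h, orderOf_dvd_iff_pow_eq_one]
  ext; simpa using hm

/-- `τ ^ i` lies in the base field iff `q²+q+1 ∣ i`. -/
lemma aux_base_iff (q : ℕ) {K L : Type} [Field K] [Field L] [Algebra K L] [Fintype K] [Finite L]
    (hK : Fintype.card K = q) (hL : Nat.card L = q ^ 3) (τ : L) (h0 : τ ≠ 0)
    (hprim : ∀ x : L, x ≠ 0 → ∃ n : ℕ, τ ^ n = x) (i : ℕ) :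
    (∃ k : K, algebraMap K L k = τ ^ i) ↔ (q ^ 2 + q + 1) ∣ i := by
  have h1 : 1 < q := hK ▸ Fintype.one_lt_card
  obtain ⟨r, rfl⟩ : ∃ r, q = r + 1 := ⟨q - 1, by omega⟩
  have hr : 0 < r := by omega
  have hf : (r + 1) ^ 3 - 1 = ((r + 1) ^ 2 + (r + 1) + 1) * r := by
    have : (r + 1) ^ 3 = ((r + 1) ^ 2 + (r + 1) + 1) * r + 1 := by ring
    omega
  constructor
  · rintro ⟨k, hk⟩
    have hk0 : k ≠ 0 := by
      rintro rfl
      exact pow_ne_zero i h0 (by simpa using hk.symm)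
    have h2 : τ ^ (i * r) = 1 := by
      have := FiniteField.pow_card_sub_one_eq_one k hk0
      rw [hK, Nat.add_sub_cancel] at this
      rw [pow_mul, ← hk, ← map_pow, this, map_one]
    have h3 := aux_order τ h0 hprim _ h2
    rw [hL, hf] at h3
    exact Nat.dvd_of_mul_dvd_mul_right hr h3
  · rintro ⟨m, rfl⟩
    apply aux_mem_base
    rw [hK]
    have : Fintype L := Fintype.ofFinite L
    have h2 := FiniteField.pow_card_sub_one_eq_one τ h0
    rw [← Nat.card_eq_fintype_card, hL, hf] at h2
    rw [← pow_mul]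
    have : ((r + 1) ^ 2 + (r + 1) + 1) * m * (r + 1) =
      (((r + 1) ^ 2 + (r + 1) + 1) * r) * m + ((r + 1) ^ 2 + (r + 1) + 1) * m := by ring
    rw [this, pow_add, pow_mul, h2, one_pow, one_mul]

/-- with Θ the projective transformation of ℙ_K(L) induced by x ↦ τx and
D̄ := {[θ⁻(e)²τ] : e ∈ K} ∪ {[τ]}, for every i ≥ 0 we have Θ^i(D̄) = D̄ iff q²+q+1 ∣ i; in
particular the orbit of D̄ under ⟨Θ⟩ has size exactly q²+q+1. -/
theorem tangent_splash_stmt_14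
    (q : ℕ) (K L : Type) [Field K] [Field L] [Algebra K L] [Fintype K]
    (hK : Fintype.card K = q)
    (τ : L) (t₀ t₁ t₂ : K)
    (B : Basis (Fin 3) K L) (hB0 : B 0 = 1) (hB1 : B 1 = τ) (hB2 : B 2 = τ ^ 2)
    (hτ3 : τ ^ 3 = algebraMap K L t₂ * τ ^ 2 + algebraMap K L t₁ * τ + algebraMap K L t₀)
    (hprim : ∀ x : L, x ≠ 0 → ∃ n : ℕ, τ ^ n = x)
    (hinj : Function.Injective (⇑(LinearMap.mulLeft K τ)))
    -- the vectors representing the points C_e (e ∈ K) and C_∞ (index `none`)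
    (Cvec : Option K → L)
    (hCe : ∀ e : K, Cvec (some e) =
      ((algebraMap K L e + τ ^ q) * (algebraMap K L e + τ ^ q ^ 2)) ^ 2 * τ)
    (hCinf : Cvec none = τ)
    (hC0 : ∀ i : Option K, Cvec i ≠ 0) :
    (∀ i : ℕ,
      (Projectivization.map (LinearMap.mulLeft K τ) hinj)^[i] ''
          Set.range (fun j : Option K => Projectivization.mk K (Cvec j) (hC0 j)) =
        Set.range (fun j : Option K => Projectivization.mk K (Cvec j) (hC0 j)) ↔
      (q ^ 2 + q + 1) ∣ i) ∧
    Set.ncard {S : Set (ℙ K L) | ∃ i : ℕ,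
      S = (Projectivization.map (LinearMap.mulLeft K τ) hinj)^[i] ''
        Set.range (fun j : Option K => Projectivization.mk K (Cvec j) (hC0 j))} =
      q ^ 2 + q + 1 := by
  classical
  have hfd : Module.Finite K L := Module.Finite.of_basis B
  have hfin : Finite L := Module.finite_of_finite K (M := L)
  have hL : Nat.card L = q ^ 3 := by
    rw [Module.natCard_eq_pow_finrank (K := K), Module.finrank_eq_card_basis B,
      Nat.card_eq_fintype_card, hK, Fintype.card_fin]
  have h0 : τ ≠ 0 := hCinf ▸ hC0 none
  have hbase := aux_base_iff q hK hL τ h0 hprim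
  have hadd : ∀ e : K, ∀ x : L, (algebraMap K L e + x) ^ q = algebraMap K L e + x ^ q := by
    intro e x
    have := map_add (FiniteField.frobeniusAlgHom K L) (algebraMap K L e) x
    rw [AlgHom.commutes, FiniteField.coe_frobeniusAlgHom, hK] at this
    exact this
  have hpq : ∀ x : L, x ^ q ^ 3 = x := by
    intro x
    have : Fintype L := Fintype.ofFinite L
    rw [← hL, Nat.card_eq_fintype_card, FiniteField.pow_card]
  -- distinctness
  let w : Option K → L := fun j => j.elim 1 (fun e => algebraMap K L e + τ)
  have hw : ∀ j, ∃ k : K, k ≠ 0 ∧ w j ^ 2 * Cvec j = algebraMap K L k * τ := by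
    intro j
    cases j with
    | none => exact ⟨1, one_ne_zero, by simp [w, hCinf]⟩
    | some e =>
      have hq2 : (algebraMap K L e + τ ^ q) ^ q = algebraMap K L e + τ ^ q ^ 2 := by
        rw [hadd, ← pow_mul, sq]
      have hq3 : (algebraMap K L e + τ ^ q ^ 2) ^ q = algebraMap K L e + τ := by
        rw [hadd, ← pow_mul, ← pow_succ, hpq]
      obtain ⟨k, hk⟩ := aux_mem_base (K := K) ((algebraMap K L e + τ) *
        ((algebraMap K L e + τ ^ q) * (algebraMap K L e + τ ^ q ^ 2))) (by
          rw [hK, mul_pow, mul_pow, hq2, hq3, hadd]; ring)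
      have hne := hC0 (some e)
      rw [hCe] at hne
      have hne2 : algebraMap K L e + τ ≠ 0 := by
        intro h
        rw [← hq3] at h
        have h' := eq_zero_of_pow_eq_zero h
        apply hne; rw [h']; simp
      have hk0 : k ≠ 0 := by
        rintro rfl
        rw [map_zero] at hk
        have h' := (mul_eq_zero.1 hk.symm).resolve_left hne2
        apply hne; rw [h']; simp
      refine ⟨k ^ 2, pow_ne_zero 2 hk0, ?_⟩
      rw [hCe, map_pow, hk]
      simp only [w, Option.elim]
      ring
  have hli : ∀ a b c : K, algebraMap K L a + algebraMap K L b * τ + algebraMap K L c * τ ^ 2 = 0 →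
      a = 0 ∧ b = 0 ∧ c = 0 := by
    intro a b c h
    have := Fintype.linearIndependent_iff.1 B.linearIndependent ![a, b, c] (by
      simp [Fin.sum_univ_three, hB0, hB1, hB2, Algebra.smul_def]
      exact h)
    exact ⟨this 0, this 1, this 2⟩
  set p : Option K → ℙ K L := fun j : Option K => Projectivization.mk K (Cvec j) (hC0 j) with hp
  have hpinj : Function.Injective p := by
    intro j j' h
    obtain ⟨a, ha⟩ := (Projectivization.mk_eq_mk_iff' K _ _ _ _).1 h
    rw [Algebra.smul_def] at ha
    obtain ⟨k, hk0, hk⟩ := hw j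
    obtain ⟨k', hk0', hk'⟩ := hw j'
    have key : algebraMap K L k' * w j ^ 2 * algebraMap K L a = algebraMap K L k * w j' ^ 2 := by
      apply mul_right_cancel₀ (mul_ne_zero (hC0 j') h0)
      calc _ = algebraMap K L k' * τ * (w j ^ 2 * (algebraMap K L a * Cvec j')) := by ring
        _ = w j' ^ 2 * Cvec j' * (algebraMap K L k * τ) := by rw [ha, hk, hk']
        _ = _ := by ring
    have ha0 : a ≠ 0 := by
      rintro rfl
      rw [map_zero, zero_mul] at ha
      exact hC0 j ha.symm
    cases j with
    | none =>
      cases j' with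
      | none => rfl
      | some e =>
        simp only [w, Option.elim] at key
        have := hli (k * e ^ 2 - k' * a) (2 * k * e) k (by
          simp only [map_mul, map_sub, map_pow, map_ofNat]
          linear_combination -key)
        exact absurd this.2.2 hk0
    | some e =>
      cases j' with
      | none =>
        simp only [w, Option.elim] at key
        have := hli (k' * a * e ^ 2 - k) (2 * k' * a * e) (k' * a) (by
          simp only [map_mul, map_sub, map_pow, map_ofNat]
          linear_combination key)
        exact absurd this.2.2 (mul_ne_zero hk0' ha0)
      | some e' =>
        simp only [w, Option.elim] at key
        obtain ⟨h1, h2, h3⟩ := hli (k' * a * e ^ 2 - k * e' ^ 2) (2 * k' * a * e - 2 * k * e')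
          (k' * a - k) (by
          simp only [map_mul, map_sub, map_pow, map_ofNat]
          linear_combination key)
        have h4 : k * (e - e') ^ 2 = 0 := by
          linear_combination (-h1) + e * h2 - e ^ 2 * h3
        have h5 := eq_zero_of_pow_eq_zero ((mul_eq_zero.1 h4).resolve_left hk0)
        rw [sub_eq_zero.1 h5]
  set f := Projectivization.map (LinearMap.mulLeft K τ) hinj with hf
  have hfinj : Function.Injective f := Projectivization.map_injective _ hinj
  have hfix : ∀ i : ℕ, (q ^ 2 + q + 1) ∣ i → f^[i] = id := by
    intro i hi
    obtain ⟨k, hk⟩ := (hbase i).2 hi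
    funext P
    induction P using Projectivization.ind with
    | h v hv =>
      rw [hf, aux_iter τ h0, id, Projectivization.mk_eq_mk_iff']
      exact ⟨k, by rw [Algebra.smul_def, hk]⟩
  have main : ∀ i : ℕ, f^[i] '' Set.range p = Set.range p ↔ (q ^ 2 + q + 1) ∣ i := by
    intro i
    constructor
    · intro h
      have hex : ∀ j, ∃ j', ∃ k : K, algebraMap K L k * Cvec j' = τ ^ i * Cvec j := by
        intro j
        have : f^[i] (p j) ∈ Set.range p := h ▸ Set.mem_image_of_mem _ ⟨j, rfl⟩
        obtain ⟨j', hj'⟩ := this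
        rw [hf, aux_iter τ h0] at hj'
        obtain ⟨k, hk⟩ := (Projectivization.mk_eq_mk_iff' K _ _ _ _).1 hj'.symm
        exact ⟨j', k, by rw [← hk, Algebra.smul_def]⟩
      choose σ k hσ using hex
      have hpσ : ∀ j, p (σ j) = f^[i] (p j) := by
        intro j
        rw [hf, aux_iter τ h0]
        symm
        rw [Projectivization.mk_eq_mk_iff']
        exact ⟨k j, by rw [Algebra.smul_def, hσ]⟩
      have hσinj : Function.Injective σ := by
        intro a b hab
        apply hpinj
        apply hfinj.iterate i
        rw [← hpσ, ← hpσ, hab]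
      have hσb : Function.Bijective σ := Finite.injective_iff_bijective.1 hσinj
      have hprod : ∏ j, (algebraMap K L (k j) * Cvec (σ j)) = ∏ j, (τ ^ i * Cvec j) :=
        Finset.prod_congr rfl (fun j _ => hσ j)
      rw [Finset.prod_mul_distrib, Finset.prod_mul_distrib, hσb.prod_comp Cvec,
        Finset.prod_const, Finset.card_univ, Fintype.card_option, hK, ← map_prod] at hprod
      have hc := mul_right_cancel₀ (Finset.prod_ne_zero_iff.2 (fun j _ => hC0 j)) hprod
      rw [← pow_mul] at hc
      have hd := (hbase _).1 ⟨_, hc⟩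
      refine Nat.Coprime.dvd_of_dvd_mul_right ?_ hd
      have : q ^ 2 + q + 1 = 1 + (q + 1) * q := by ring
      rw [this]
      simp
    · intro hi
      rw [hfix i hi, Set.image_id]
  refine ⟨main, ?_⟩
  have hset : {S : Set (ℙ K L) | ∃ i : ℕ, S = f^[i] '' Set.range p} =
      (fun i : ℕ => f^[i] '' Set.range p) '' (Finset.range (q ^ 2 + q + 1) : Set ℕ) := by
    ext S
    constructor
    · rintro ⟨i, rfl⟩
      refine ⟨i % (q ^ 2 + q + 1), by simpa using Nat.mod_lt i (Nat.succ_pos (q ^ 2 + q)), ?_⟩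
      conv_rhs => rw [← Nat.mod_add_div i (q ^ 2 + q + 1), Function.iterate_add,
        hfix _ (Dvd.intro _ rfl), Function.comp_id]
    · rintro ⟨i, -, rfl⟩
      exact ⟨i, rfl⟩
  have hle : ∀ a b : ℕ, a ≤ b → b < q ^ 2 + q + 1 →
      f^[a] '' Set.range p = f^[b] '' Set.range p → a = b := by
    intro a b hab hb h
    obtain ⟨c, rfl⟩ := Nat.exists_eq_add_of_le hab
    rw [Function.iterate_add, Set.image_comp] at h
    have h' := (hfinj.iterate a).image_injective h
    have hd := (main c).1 h'.symm
    have := Nat.eq_zero_of_dvd_of_lt hd (by omega)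
    omega
  rw [hset, Set.ncard_image_of_injOn, Set.ncard_coe_finset, Finset.card_range]
  intro a ha b hb h
  simp only [Finset.coe_range, Set.mem_Iio] at ha hb
  rcases le_total a b with hab | hab
  · exact hle a b hab hb h
  · exact (hle b a hab ha h.symm).symm
end

section
/- For a ∈ K define f(a) := 1 + a·t₂ − a²·t₁ + a·τ + a²·τ² ∈ L. For each a ∈ K, the K-span π_a of {(1,0), (τ+aτ², 0), (0, f(a))} ⊆ L×L is a cover plane of the coordinatised tangent splash: it is 3-dimensional, meets S_∞ in exactly the 2-dimensional subspace spanned by (1,0) and (τ+aτ²,0), meets S_0 in exactly K·(0,f(a)), and meets S_α nontrivially for every α ∈ K+Kτ. The same holds for π_∞ := span_K{(1,0), (τ²,0), (0, −t₁+τ²)}. Moreover, the q+1 subspaces π_a ∩ S_∞ (a ∈ K ∪ {∞}) are precisely the q+1 lines of ℙ(S_∞) passing through the point represented by (1,0). -/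
open scoped LinearAlgebra.Projectivization
open Module

noncomputable section

/-- The 3-dimensional K-subspace S_α := {(xα, x) : x ∈ L} of L × L. -/
def Ssub (K L : Type*) [Field K] [Field L] [Algebra K L] (α : L) : Submodule K (L × L) :=
  LinearMap.range ((LinearMap.mulRight K α).prod LinearMap.id)

/-- The 3-dimensional K-subspace S_∞ := {(x, 0) : x ∈ L} of L × L. -/
def Sinf (K L : Type*) [Field K] [Field L] [Algebra K L] : Submodule K (L × L) :=
  (⊤ : Submodule K L).prod (⊥ : Submodule K L)

/-- A cover plane of the coordinatised tangent splash: a 3-dimensional K-subspace of L × L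
having nonzero intersection with the centre S_∞ and with each splash element S_{a+bτ}. -/
def IsCoverPlane (K L : Type*) [Field K] [Field L] [Algebra K L] (τ : L)
    (W : Submodule K (L × L)) : Prop :=
  Module.finrank K W = 3 ∧ W ⊓ Sinf K L ≠ ⊥ ∧
    ∀ a b : K, W ⊓ Ssub K L (algebraMap K L a + algebraMap K L b * τ) ≠ ⊥

section helpers
variable {K L : Type} [Field K] [Field L] [Algebra K L]

theorem mem_Sinf_iff (v : L × L) : v ∈ Sinf K L ↔ v.2 = 0 := by
  simp [Sinf, Submodule.mem_prod]

theorem mem_Ssub_iff (α : L) (v : L × L) : v ∈ Ssub K L α ↔ v.1 = v.2 * α := by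
  constructor
  · rintro ⟨x, rfl⟩
    simp
  · intro h
    exact ⟨v.2, by ext <;> simp [h]⟩

theorem mem_pi_iff (s g : L) (v : L × L) :
    v ∈ Submodule.span K {((1 : L), (0 : L)), (s, 0), (0, g)} ↔
      ∃ x y z : K, v.1 = algebraMap K L x + algebraMap K L y * s ∧
        v.2 = algebraMap K L z * g := by
  rw [Submodule.mem_span_triple]
  constructor
  · rintro ⟨x, y, z, rfl⟩
    exact ⟨x, y, z, by simp [Algebra.smul_def], by simp [Algebra.smul_def]⟩
  · rintro ⟨x, y, z, h1, h2⟩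
    exact ⟨x, y, z, by ext <;> simp [Algebra.smul_def, h1, h2]⟩

theorem mem_line_iff (s : L) (v : L × L) :
    v ∈ Submodule.span K {((1 : L), (0 : L)), (s, 0)} ↔
      ∃ x y : K, v.1 = algebraMap K L x + algebraMap K L y * s ∧ v.2 = 0 := by
  rw [Submodule.mem_span_pair]
  constructor
  · rintro ⟨x, y, rfl⟩
    exact ⟨x, y, by simp [Algebra.smul_def], by simp⟩
  · rintro ⟨x, y, h1, h2⟩
    exact ⟨x, y, by ext <;> simp [Algebra.smul_def, h1, h2]⟩

theorem finrank_pi (s g : L)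
    (hs : ∀ x y : K, algebraMap K L x + algebraMap K L y * s = 0 → x = 0 ∧ y = 0)
    (hg : g ≠ 0) :
    Module.finrank K (Submodule.span K {((1 : L), (0 : L)), (s, 0), (0, g)}) = 3 := by
  have hli : LinearIndependent K ![((1 : L), (0 : L)), (s, 0), (0, g)] := by
    rw [Fintype.linearIndependent_iff]
    intro c hc
    rw [Fin.sum_univ_three] at hc
    have h1 := congrArg Prod.fst hc
    have h2 := congrArg Prod.snd hc
    simp [Algebra.smul_def, hg] at h1 h2
    obtain ⟨h3, h4⟩ := hs _ _ h1
    intro i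
    fin_cases i <;> assumption
  have h := finrank_span_eq_card hli
  have hr : Set.range ![((1 : L), (0 : L)), (s, 0), (0, g)]
      = {((1 : L), (0 : L)), (s, 0), (0, g)} := by
    ext v
    simp
    tauto
  rw [hr] at h
  simpa using h

theorem finrank_line (s : L)
    (hs : ∀ x y : K, algebraMap K L x + algebraMap K L y * s = 0 → x = 0 ∧ y = 0) :
    Module.finrank K (Submodule.span K {((1 : L), (0 : L)), (s, 0)}) = 2 := by
  have hli : LinearIndependent K ![((1 : L), (0 : L)), (s, 0)] := by
    rw [LinearIndependent.pair_iff]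
    intro x y hc
    have h1 := congrArg Prod.fst hc
    simp [Algebra.smul_def] at h1
    exact hs _ _ h1
  have h := finrank_span_eq_card hli
  have hr : Set.range ![((1 : L), (0 : L)), (s, 0)] = {((1 : L), (0 : L)), (s, 0)} := by
    ext v
    simp
    tauto
  rw [hr] at h
  simpa using h

theorem pi_inf_Sinf (s g : L) (hg : g ≠ 0) :
    Submodule.span K {((1 : L), (0 : L)), (s, 0), (0, g)} ⊓ Sinf K L =
      Submodule.span K {((1 : L), (0 : L)), (s, 0)} := by
  ext v
  rw [Submodule.mem_inf, mem_pi_iff, mem_Sinf_iff, mem_line_iff]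
  constructor
  · rintro ⟨⟨x, y, z, h1, h2⟩, h⟩
    exact ⟨x, y, h1, h⟩
  · rintro ⟨x, y, h1, h2⟩
    exact ⟨⟨x, y, 0, h1, by simp [h2]⟩, h2⟩

theorem pi_inf_Szero (s g : L) :
    Submodule.span K {((1 : L), (0 : L)), (s, 0), (0, g)} ⊓ Ssub K L 0 =
      Submodule.span K {((0 : L), g)} := by
  ext v
  rw [Submodule.mem_inf, mem_pi_iff, mem_Ssub_iff, Submodule.mem_span_singleton]
  constructor
  · rintro ⟨⟨x, y, z, h1, h2⟩, h⟩
    exact ⟨z, by ext <;> simp [Algebra.smul_def, h, h2]⟩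
  · rintro ⟨z, rfl⟩
    exact ⟨⟨0, 0, z, by simp, by simp [Algebra.smul_def]⟩, by simp⟩

theorem pi_inf_Ssub (s g τ : L) (hg : g ≠ 0) (x y x' y' : K)
    (h1 : g = algebraMap K L x + algebraMap K L y * s)
    (h2 : g * τ = algebraMap K L x' + algebraMap K L y' * s) (a b : K) :
    Submodule.span K {((1 : L), (0 : L)), (s, 0), (0, g)} ⊓
      Ssub K L (algebraMap K L a + algebraMap K L b * τ) ≠ ⊥ := by
  rw [Submodule.ne_bot_iff]
  refine ⟨(g * (algebraMap K L a + algebraMap K L b * τ), g), ?_, ?_⟩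
  · rw [Submodule.mem_inf, mem_pi_iff, mem_Ssub_iff]
    refine ⟨⟨a * x + b * x', a * y + b * y', 1, ?_, by simp⟩, rfl⟩
    simp only [map_add, map_mul]
    linear_combination algebraMap K L a * h1 + algebraMap K L b * h2
  · intro h
    exact hg (congrArg Prod.snd h)

end helpers

/-- with f(a) := 1 + a·t₂ − a²·t₁ + a·τ + a²·τ², for each a ∈ K the K-span π_a of
{(1,0), (τ+aτ²,0), (0,f(a))} is a cover plane of the coordinatised tangent splash, meeting S_∞
exactly in span{(1,0),(τ+aτ²,0)}, meeting S_0 exactly in K·(0,f(a)), and meeting every S_{a'+b'τ}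
nontrivially; the same holds for π_∞ := span{(1,0), (τ²,0), (0,−t₁+τ²)}. Moreover the q+1
subspaces π_a ⊓ S_∞ (a ∈ K ∪ {∞}) are precisely the q+1 lines of ℙ(S_∞) through [(1,0)]. -/
theorem tangent_splash_stmt_15
    (q : ℕ) (K L : Type) [Field K] [Field L] [Algebra K L] [Fintype K]
    (hK : Fintype.card K = q)
    (τ : L) (t₀ t₁ t₂ : K)
    (B : Basis (Fin 3) K L) (hB0 : B 0 = 1) (hB1 : B 1 = τ) (hB2 : B 2 = τ ^ 2)
    (hτ3 : τ ^ 3 = algebraMap K L t₂ * τ ^ 2 + algebraMap K L t₁ * τ + algebraMap K L t₀)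
    (hprim : ∀ x : L, x ≠ 0 → ∃ n : ℕ, τ ^ n = x)
    -- the second spanning vectors (τ+aτ² for a ∈ K, τ² for ∞)
    (s : Option K → L)
    (hs : ∀ a : K, s (some a) = τ + algebraMap K L a * τ ^ 2) (hsinf : s none = τ ^ 2)
    -- the third spanning vectors (f(a) for a ∈ K, −t₁+τ² for ∞)
    (g : Option K → L)
    (hg : ∀ a : K, g (some a) =
      algebraMap K L (1 + a * t₂ - a ^ 2 * t₁) + algebraMap K L a * τ +
        algebraMap K L (a ^ 2) * τ ^ 2)
    (hginf : g none = -algebraMap K L t₁ + τ ^ 2)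
    -- the planes π_a (a ∈ K ∪ {∞})
    (π : Option K → Submodule K (L × L))
    (hπ : ∀ i : Option K, π i =
      Submodule.span K {((1 : L), (0 : L)), (s i, 0), (0, g i)}) :
    (∀ i : Option K,
      -- π_i is a plane and a cover plane of the coordinatised tangent splash
      Module.finrank K ↥(π i) = 3 ∧ IsCoverPlane K L τ (π i) ∧
      -- it meets S_∞ exactly in the line spanned by (1,0) and (s i, 0)
      π i ⊓ Sinf K L = Submodule.span K {((1 : L), (0 : L)), (s i, 0)} ∧
      Module.finrank K ↥(π i ⊓ Sinf K L) = 2 ∧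
      -- it meets S_0 exactly in K·(0, g i)
      π i ⊓ Ssub K L 0 = Submodule.span K {((0 : L), g i)} ∧
      -- it meets every splash element S_{a+bτ} nontrivially
      ∀ a b : K, π i ⊓ Ssub K L (algebraMap K L a + algebraMap K L b * τ) ≠ ⊥) ∧
    -- the π_i ⊓ S_∞ are pairwise distinct and are precisely the lines of ℙ(S_∞) through [(1,0)]
    Function.Injective (fun i : Option K => π i ⊓ Sinf K L) ∧
    {M : Submodule K (L × L) | ∃ i : Option K, M = π i ⊓ Sinf K L} =
      {M : Submodule K (L × L) | M ≤ Sinf K L ∧ Module.finrank K M = 2 ∧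
        ((1 : L), (0 : L)) ∈ M} := by
  have coord : ∀ x y z : K,
      algebraMap K L x + algebraMap K L y * τ + algebraMap K L z * τ ^ 2 = 0 →
        x = 0 ∧ y = 0 ∧ z = 0 := by
    intro x y z h
    have hli := Fintype.linearIndependent_iff.1 B.linearIndependent ![x, y, z]
      (by simp [Fin.sum_univ_three, hB0, hB1, hB2, Algebra.smul_def, h])
    exact ⟨hli 0, hli 1, hli 2⟩
  have expand : ∀ m : L, ∃ x y z : K,
      m = algebraMap K L x + algebraMap K L y * τ + algebraMap K L z * τ ^ 2 := by
    intro m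
    refine ⟨B.repr m 0, B.repr m 1, B.repr m 2, ?_⟩
    have h := B.sum_repr m
    rw [Fin.sum_univ_three, hB0, hB1, hB2] at h
    simpa [Algebra.smul_def] using h.symm
  have hsi : ∀ (i : Option K) (x y : K),
      algebraMap K L x + algebraMap K L y * s i = 0 → x = 0 ∧ y = 0 := by
    rintro (_ | a) x y h
    · rw [hsinf] at h
      have := coord x 0 y (by simpa using h)
      exact ⟨this.1, this.2.2⟩
    · rw [hs] at h
      have := coord x y (y * a) (by rw [map_mul]; linear_combination h)
      exact ⟨this.1, this.2.1⟩
  have hg0 : ∀ i : Option K, g i ≠ 0 := by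
    rintro (_ | a) h
    · rw [hginf] at h
      have := coord (-t₁) 0 1 (by simpa using h)
      exact one_ne_zero this.2.2
    · rw [hg] at h
      obtain ⟨h1, h2, h3⟩ := coord _ _ _ h
      subst h2
      simp at h1
  have hg1 : ∀ i : Option K, ∃ x y : K, g i = algebraMap K L x + algebraMap K L y * s i := by
    rintro (_ | a)
    · exact ⟨-t₁, 1, by rw [hginf, hsinf]; simp⟩
    · refine ⟨1 + a * t₂ - a ^ 2 * t₁, a, ?_⟩
      rw [hg, hs, map_pow]
      ring
  have hg2 : ∀ i : Option K,
      ∃ x y : K, g i * τ = algebraMap K L x + algebraMap K L y * s i := by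
    rintro (_ | a)
    · refine ⟨t₀, t₂, ?_⟩
      rw [hginf, hsinf]
      linear_combination hτ3
    · refine ⟨a ^ 2 * t₀, 1 + a * t₂, ?_⟩
      rw [hg, hs]
      simp only [map_add, map_sub, map_mul, map_pow, map_one]
      linear_combination (algebraMap K L a) ^ 2 * hτ3
  have hmeet : ∀ i : Option K, π i ⊓ Sinf K L =
      Submodule.span K {((1 : L), (0 : L)), (s i, 0)} := by
    intro i
    rw [hπ, pi_inf_Sinf _ _ (hg0 i)]
  have hfr : ∀ i : Option K, Module.finrank K ↥(π i ⊓ Sinf K L) = 2 := by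
    intro i
    rw [hmeet, finrank_line _ (hsi i)]
  have hfr3 : ∀ i : Option K, Module.finrank K ↥(π i) = 3 := by
    intro i
    rw [hπ, finrank_pi _ _ (hsi i) (hg0 i)]
  have hS : ∀ (i : Option K) (a b : K),
      π i ⊓ Ssub K L (algebraMap K L a + algebraMap K L b * τ) ≠ ⊥ := by
    intro i a b
    obtain ⟨x, y, h1⟩ := hg1 i
    obtain ⟨x', y', h2⟩ := hg2 i
    rw [hπ]
    exact pi_inf_Ssub _ _ _ (hg0 i) x y x' y' h1 h2 a b
  refine ⟨fun i => ⟨hfr3 i, ⟨hfr3 i, ?_, hS i⟩, hmeet i, hfr i, ?_, hS i⟩, ?_, ?_⟩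
  · intro h
    have h2 := hfr i
    rw [h, finrank_bot] at h2
    omega
  · rw [hπ, pi_inf_Szero]
  · intro i j hij
    simp only [hmeet] at hij
    have hmem : (s i, (0 : L)) ∈ Submodule.span K {((1 : L), (0 : L)), (s j, 0)} := by
      rw [← hij]
      exact Submodule.subset_span (by simp)
    rw [mem_line_iff] at hmem
    obtain ⟨x, y, h, -⟩ := hmem
    simp only at h
    rcases i with _ | a <;> rcases j with _ | b
    · rfl
    · rw [hsinf, hs] at h
      obtain ⟨-, h2, h3⟩ := coord x y (y * b - 1)
        (by simp only [map_sub, map_mul, map_one]; linear_combination -h)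
      simp [h2] at h3
    · rw [hsinf, hs] at h
      obtain ⟨-, h2, h3⟩ := coord x (-1) (y - a)
        (by simp only [map_sub, map_neg, map_one]; linear_combination -h)
      simp at h2
    · rw [hs, hs] at h
      obtain ⟨-, h2, h3⟩ := coord x (y - 1) (y * b - a)
        (by simp only [map_sub, map_mul, map_one]; linear_combination -h)
      rw [sub_eq_zero] at h2 h3
      rw [h2, one_mul] at h3
      rw [h3]
  · ext M
    simp only [Set.mem_setOf_eq]
    constructor
    · rintro ⟨i, rfl⟩
      refine ⟨inf_le_right, hfr i, ?_⟩
      rw [hmeet]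
      exact Submodule.subset_span (by simp)
    · rintro ⟨hM, hM2, h1⟩
      haveI : FiniteDimensional K L := B.finiteDimensional_of_finite
      have key : ∃ i : Option K, (s i, (0 : L)) ∈ M := by
        have hne : ∃ v ∈ M, v ∉ Submodule.span K {((1 : L), (0 : L))} := by
          by_contra hcon
          push Not at hcon
          have hle : M ≤ Submodule.span K {((1 : L), (0 : L))} := hcon
          have h3 := Submodule.finrank_mono hle
          rw [finrank_span_singleton (by simp), hM2] at h3
          omega
        obtain ⟨⟨m, m'⟩, hv, hv'⟩ := hne
        have hm' : m' = 0 := (mem_Sinf_iff _).1 (hM hv)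
        subst hm'
        obtain ⟨x, y, z, rfl⟩ := expand m
        have hv2 : (algebraMap K L y * τ + algebraMap K L z * τ ^ 2, (0 : L)) ∈ M := by
          have := M.sub_mem hv (M.smul_mem x h1)
          convert this using 1
          ext <;> simp [Algebra.smul_def]
          ring
        by_cases hy : y = 0
        · subst hy
          have hz : z ≠ 0 := by
            rintro rfl
            apply hv'
            rw [Submodule.mem_span_singleton]
            exact ⟨x, by ext <;> simp [Algebra.smul_def]⟩
          refine ⟨none, ?_⟩
          have := M.smul_mem z⁻¹ hv2
          convert this using 1
          have hz' : algebraMap K L z ≠ 0 := by simpa using hz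
          ext <;> simp [Algebra.smul_def, hsinf, hz']
        · refine ⟨some (z / y), ?_⟩
          have := M.smul_mem y⁻¹ hv2
          convert this using 1
          have hy' : algebraMap K L y ≠ 0 := by simpa using hy
          ext
          · rw [Prod.smul_fst, hs, Algebra.smul_def, map_div₀, map_inv₀]
            field_simp
          · simp
      obtain ⟨i, hi⟩ := key
      refine ⟨i, ?_⟩
      symm
      apply Submodule.eq_of_le_of_finrank_eq
      · rw [hmeet, Submodule.span_le]
        rintro v (rfl | rfl)
        · exact h1
        · exact hi
      · rw [hfr, hM2]

end
end

section
/- For each e ∈ K, the K-span W_e of {(τθ⁻(e), 0), (τθ⁻(e)², 0), (0, τθ⁻(e)²)} ⊆ L×L is 3-dimensional and is a cover plane of the coordinatised tangent splash: it meets S_α nontrivially for every α ∈ K+Kτ. Likewise W_∞ := span_K{(τ, 0), (τ², 0), (0, τ)} is a cover plane. Moreover W_e ∩ S_∞ is exactly the 2-dimensional subspace spanned by (τθ⁻(e),0) and (τθ⁻(e)²,0); under the identification (x,0) ↦ x of S_∞ with L, this is the tangent line at [θ⁻(e)τ] to the conic {[θ⁻(f)τ] : f ∈ K} ∪ {[τ]}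 of ℙ_K(L), and similarly W_∞ ∩ S_∞ corresponds to the tangent line at [τ]. -/
open scoped LinearAlgebra.Projectivization
open Module

noncomputable section

/-- Any nonzero norm relation. -/
theorem aux_norm (q : ℕ) (K L : Type) [Field K] [Field L] [Algebra K L] [Fintype K]
    (hK : Fintype.card K = q) (τ : L) (B : Basis (Fin 3) K L) (e : K)
    (hne : algebraMap K L e + τ ≠ 0) :
    ∃ n : K, n ≠ 0 ∧ (algebraMap K L e + τ) *
      ((algebraMap K L e + τ ^ q) * (algebraMap K L e + τ ^ q ^ 2)) = algebraMap K L n := by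
  have : Module.Finite K L := Module.Finite.of_basis B
  have hfin : Finite L := Module.finite_of_finite K
  have hr : finrank K L = 3 := by simpa using Module.finrank_eq_card_basis B
  have hc : Nat.card K = q := by rw [Nat.card_eq_fintype_card, hK]
  have hf : ∀ x : L, FiniteField.frobeniusAlgHom K L x = x ^ q := by
    intro x; rw [FiniteField.coe_frobeniusAlgHom, ← hK]
  have h1 : ∀ y : L, (algebraMap K L e + y) ^ q = algebraMap K L e + y ^ q := by
    intro y; rw [← hf, map_add, AlgHom.commutes, hf]
  refine ⟨Algebra.norm K (algebraMap K L e + τ), ?_, ?_⟩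
  · exact Algebra.norm_ne_zero_iff.2 hne
  · rw [FiniteField.algebraMap_norm_eq_prod_pow, hr, hc]
    simp only [Finset.prod_range_succ, Finset.prod_range_zero, pow_zero, pow_one, one_mul]
    rw [h1, pow_two q, pow_mul, pow_mul, h1, h1, mul_assoc]

/-- The product of two submodules as a module. -/
def aux_prod {K L : Type} [Field K] [AddCommGroup L] [Module K L] (p r : Submodule K L) :
    (p.prod r) ≃ₗ[K] p × r where
  toFun x := (⟨x.1.1, x.2.1⟩, ⟨x.1.2, x.2.2⟩)
  invFun y := ⟨(y.1.1, y.2.1), ⟨y.1.2, y.2.2⟩⟩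
  map_add' _ _ := rfl
  map_smul' _ _ := rfl
  left_inv _ := rfl
  right_inv _ := rfl

theorem aux_main (K L : Type) [Field K] [Field L] [Algebra K L]
    (τ x₁ x₂ u v : L) (a : K)
    (hli : ∀ a b c : K, algebraMap K L a + algebraMap K L b * τ + algebraMap K L c * τ ^ 2 = 0 →
      a = 0 ∧ b = 0 ∧ c = 0)
    (hv : v ≠ 0) (hu : u = algebraMap K L a * v) (ha : a ≠ 0)
    (hmem : ∀ x : L, x ∈ Submodule.span K {x₁, x₂} ↔
      ∃ a b : K, x = v * (algebraMap K L a + algebraMap K L b * τ)) :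
    finrank K (Submodule.span K {(x₁, (0 : L)), (x₂, 0), (0, u)}) = 3 ∧
    finrank K (Submodule.span K {x₁, x₂}) = 2 ∧
    (Submodule.span K {(x₁, (0 : L)), (x₂, 0), (0, u)} ⊓ Sinf K L =
      Submodule.map (LinearMap.inl K L L) (Submodule.span K {x₁, x₂})) ∧
    (Submodule.span K {(x₁, (0 : L)), (x₂, 0), (0, u)} ⊓ Sinf K L ≠ ⊥) ∧
    ∀ a b : K, Submodule.span K {(x₁, (0 : L)), (x₂, 0), (0, u)} ⊓
      Ssub K L (algebraMap K L a + algebraMap K L b * τ) ≠ ⊥ := by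
  have hu0 : u ≠ 0 := by
    rw [hu]; exact mul_ne_zero (by simpa using ha) hv
  have hW : Submodule.span K {(x₁, (0 : L)), (x₂, 0), (0, u)} =
      (Submodule.span K {x₁, x₂}).prod (Submodule.span K {u}) := by
    ext ⟨x, y⟩
    simp only [Submodule.mem_span_insert, Submodule.mem_span_singleton, Submodule.mem_prod]
    constructor
    · rintro ⟨p, z, ⟨r, z', ⟨s, rfl⟩, rfl⟩, h⟩
      simp only [Prod.smul_mk, smul_zero, Prod.mk_add_mk, Prod.mk.injEq, zero_add, add_zero] at h
      exact ⟨⟨p, _, ⟨r, rfl⟩, h.1⟩, ⟨s, h.2.symm⟩⟩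
    · rintro ⟨⟨p, z, ⟨r, rfl⟩, h⟩, ⟨s, h'⟩⟩
      refine ⟨p, _, ⟨r, _, ⟨s, rfl⟩, rfl⟩, ?_⟩
      simp [h, ← h']
  have hvm : ∀ a b : K, v * (algebraMap K L a + algebraMap K L b * τ) ∈
      Submodule.span K {x₁, x₂} := fun a b => (hmem _).2 ⟨a, b, rfl⟩
  have h2 : finrank K (Submodule.span K {x₁, x₂}) = 2 := by
    have hE : Submodule.span K {x₁, x₂} = Submodule.span K (Set.range ![v, v * τ]) := by
      ext x
      rw [hmem, Matrix.range_cons, Matrix.range_cons, Matrix.range_empty, Set.union_empty,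
        Set.singleton_union, Submodule.mem_span_pair]
      simp only [Algebra.smul_def]
      constructor
      · rintro ⟨a, b, rfl⟩; exact ⟨a, b, by ring⟩
      · rintro ⟨a, b, rfl⟩; exact ⟨a, b, by ring⟩
    rw [hE, finrank_span_eq_card]
    · simp
    · rw [LinearIndependent.pair_iff]
      intro s t h
      simp only [Algebra.smul_def] at h
      have h' : v * (algebraMap K L s + algebraMap K L t * τ) = 0 := by rw [← h]; ring
      have := hli s t 0 (by simpa using (mul_eq_zero.1 h').resolve_left hv)
      exact ⟨this.1, this.2.1⟩
  have hinf : Submodule.span K {(x₁, (0 : L)), (x₂, 0), (0, u)} ⊓ Sinf K L =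
      Submodule.map (LinearMap.inl K L L) (Submodule.span K {x₁, x₂}) := by
    rw [hW]
    ext ⟨x, y⟩
    simp only [Sinf, Submodule.mem_inf, Submodule.mem_prod, Submodule.mem_top, Submodule.mem_bot,
      true_and, Submodule.mem_map, LinearMap.inl_apply, Prod.mk.injEq]
    constructor
    · rintro ⟨⟨h, -⟩, rfl⟩; exact ⟨x, h, rfl, rfl⟩
    · rintro ⟨_, h, rfl, rfl⟩; exact ⟨⟨h, zero_mem _⟩, rfl⟩
  refine ⟨?_, h2, hinf, ?_, ?_⟩
  · rw [hW]
    have : Module.Finite K (Submodule.span K {x₁, x₂}) := Module.finite_of_finrank_eq_succ h2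
    rw [(aux_prod (Submodule.span K {x₁, x₂}) (Submodule.span K {u})).finrank_eq,
      finrank_prod, h2, finrank_span_singleton hu0]
  · rw [hinf]
    rw [Submodule.ne_bot_iff]
    exact ⟨(v, 0), ⟨v, by simpa using hvm 1 0, rfl⟩, by simp [hv]⟩
  · intro r s
    rw [hW, Submodule.ne_bot_iff]
    refine ⟨(u * (algebraMap K L r + algebraMap K L s * τ), u), ⟨⟨?_, ?_⟩, ⟨u, rfl⟩⟩, by simp [hu0]⟩
    · have := hvm (a * r) (a * s)
      have he : u * (algebraMap K L r + algebraMap K L s * τ) =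
          v * (algebraMap K L (a * r) + algebraMap K L (a * s) * τ) := by
        simp only [hu, map_mul]; ring
      rw [← he] at this
      exact this
    · exact Submodule.mem_span_singleton_self u

/-- for each e ∈ K, W_e := span{(τθ⁻(e),0), (τθ⁻(e)²,0), (0,τθ⁻(e)²)} is a cover
plane of the coordinatised tangent splash, as is W_∞ := span{(τ,0), (τ²,0), (0,τ)}. Moreover
W_e ⊓ S_∞ is exactly the image under x ↦ (x,0) of span{τθ⁻(e), τθ⁻(e)²}, which, identifying S_∞
with L, is the tangent line at [θ⁻(e)τ] to the conic {[θ⁻(f)τ] : f ∈ K} ∪ {[τ]} of ℙ_K(L);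
similarly W_∞ ⊓ S_∞ corresponds to the tangent line at [τ]. -/
theorem tangent_splash_stmt_18
    (q : ℕ) (K L : Type) [Field K] [Field L] [Algebra K L] [Fintype K]
    (hK : Fintype.card K = q)
    (τ : L) (t₀ t₁ t₂ : K)
    (B : Basis (Fin 3) K L) (hB0 : B 0 = 1) (hB1 : B 1 = τ) (hB2 : B 2 = τ ^ 2)
    (hτ3 : τ ^ 3 = algebraMap K L t₂ * τ ^ 2 + algebraMap K L t₁ * τ + algebraMap K L t₀)
    (hprim : ∀ x : L, x ≠ 0 → ∃ n : ℕ, τ ^ n = x)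
    -- the vectors τθ⁻(e) (for e ∈ K) and τ (for the index `none`): these represent the
    -- points C_e, C_∞ of the conic
    (tv₁ : Option K → L)
    (h1e : ∀ e : K, tv₁ (some e) =
      τ * ((algebraMap K L e + τ ^ q) * (algebraMap K L e + τ ^ q ^ 2)))
    (h1inf : tv₁ none = τ)
    (h10 : ∀ i : Option K, tv₁ i ≠ 0)
    -- the vectors τθ⁻(e)² (for e ∈ K) and τ² (for the index `none`)
    (tv₂ : Option K → L)
    (h2e : ∀ e : K, tv₂ (some e) =
      τ * ((algebraMap K L e + τ ^ q) * (algebraMap K L e + τ ^ q ^ 2)) ^ 2)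
    (h2inf : tv₂ none = τ ^ 2)
    -- the second components of the third spanning vectors: τθ⁻(e)² (for e ∈ K) and τ (for `none`)
    (u : Option K → L)
    (hue : ∀ e : K, u (some e) =
      τ * ((algebraMap K L e + τ ^ q) * (algebraMap K L e + τ ^ q ^ 2)) ^ 2)
    (huinf : u none = τ)
    -- the subspaces W_e (e ∈ K) and W_∞ (index `none`)
    (W : Option K → Submodule K (L × L))
    (hW : ∀ i : Option K, W i = Submodule.span K {(tv₁ i, (0 : L)), (tv₂ i, 0), (0, u i)}) :
    ∀ i : Option K,
      -- W_i is 3-dimensional and is a cover plane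
      Module.finrank K ↥(W i) = 3 ∧ IsCoverPlane K L τ (W i) ∧
      (∀ a b : K, W i ⊓ Ssub K L (algebraMap K L a + algebraMap K L b * τ) ≠ ⊥) ∧
      -- W_i ⊓ S_∞ is exactly the image of span{tv₁ i, tv₂ i} under x ↦ (x, 0)
      W i ⊓ Sinf K L =
        Submodule.map (LinearMap.inl K L L) (Submodule.span K {tv₁ i, tv₂ i}) ∧
      -- span{tv₁ i, tv₂ i} is a line of ℙ_K(L) through the conic point represented by tv₁ i,
      -- and it is the tangent line there: it meets the conic only in that point
      Module.finrank K ↥(Submodule.span K {tv₁ i, tv₂ i}) = 2 ∧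
      (Projectivization.mk K (tv₁ i) (h10 i)).submodule ≤ Submodule.span K {tv₁ i, tv₂ i} ∧
      (∀ P ∈ Set.range (fun j : Option K => Projectivization.mk K (tv₁ j) (h10 j)),
        P.submodule ≤ Submodule.span K {tv₁ i, tv₂ i} →
          P = Projectivization.mk K (tv₁ i) (h10 i)) := by
  have hli : ∀ a b c : K, algebraMap K L a + algebraMap K L b * τ + algebraMap K L c * τ ^ 2 = 0 →
      a = 0 ∧ b = 0 ∧ c = 0 := by
    intro a b c h
    have := Fintype.linearIndependent_iff.1 B.linearIndependent ![a, b, c] (by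
      simp only [Fin.sum_univ_three, hB0, hB1, hB2, Algebra.smul_def]
      simpa using h)
    exact ⟨by simpa using this 0, by simpa using this 1, by simpa using this 2⟩
  have hτ0 : τ ≠ 0 := by rw [← h1inf]; exact h10 none
  have hs0 : ∀ e : K, algebraMap K L e + τ ≠ 0 := by
    intro e h
    have := hli e 1 0 (by simpa using h)
    exact one_ne_zero this.2.1
  choose N hN0 hN using fun e : K => aux_norm q K L hK τ B e (hs0 e)
  have hN0' : ∀ e : K, algebraMap K L (N e) ≠ 0 := fun e => by simpa using hN0 e
  -- θ⁻ is a scalar multiple of the inverse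
  have hth : ∀ e : K, (algebraMap K L e + τ ^ q) * (algebraMap K L e + τ ^ q ^ 2) =
      algebraMap K L (N e) / (algebraMap K L e + τ) := by
    intro e
    rw [eq_div_iff (hs0 e), ← hN e]; ring
  have key : ∀ i : Option K, ∃ (v : L) (a : K), v ≠ 0 ∧ u i = algebraMap K L a * v ∧ a ≠ 0 ∧
      (∀ x : L, x ∈ Submodule.span K {tv₁ i, tv₂ i} ↔
        ∃ a b : K, x = v * (algebraMap K L a + algebraMap K L b * τ)) ∧
      (∀ j : Option K, tv₁ j ∈ Submodule.span K {tv₁ i, tv₂ i} → j = i) := by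
    intro i
    cases i with
    | none =>
      have hm : ∀ x : L, x ∈ Submodule.span K {tv₁ none, tv₂ none} ↔
          ∃ a b : K, x = τ * (algebraMap K L a + algebraMap K L b * τ) := by
        intro x
        rw [Submodule.mem_span_pair, h1inf, h2inf]
        simp only [Algebra.smul_def]
        constructor
        · rintro ⟨a, b, rfl⟩; exact ⟨a, b, by ring⟩
        · rintro ⟨a, b, rfl⟩; exact ⟨a, b, by ring⟩
      refine ⟨τ, 1, hτ0, by simp [huinf], one_ne_zero, hm, ?_⟩
      intro j hj
      cases j with
      | none => rfl
      | some e =>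
        exfalso
        rw [hm, h1e, hth] at hj
        obtain ⟨a, b, h⟩ := hj
        have h' := mul_left_cancel₀ hτ0 h
        rw [div_eq_iff (hs0 e)] at h'
        obtain ⟨p1, p2, p3⟩ := hli (a * e - N e) (a + b * e) b (by
          simp only [map_sub, map_add, map_mul]
          rw [h']; ring)
        apply hN0 e
        subst p3
        have : a = 0 := by simpa using p2
        subst this
        simpa using p1
    | some e =>
      have hse := hs0 e
      have hm : ∀ x : L, x ∈ Submodule.span K {tv₁ (some e), tv₂ (some e)} ↔
          ∃ a b : K, x = τ / (algebraMap K L e + τ) ^ 2 *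
            (algebraMap K L a + algebraMap K L b * τ) := by
        intro x
        rw [Submodule.mem_span_pair, h1e, h2e, hth]
        simp only [Algebra.smul_def]
        constructor
        · rintro ⟨a, b, rfl⟩
          refine ⟨a * N e * e + b * N e ^ 2, a * N e, ?_⟩
          simp only [map_add, map_mul, map_pow]
          field_simp
          ring
        · rintro ⟨a, b, rfl⟩
          have := hN0' e
          refine ⟨b / N e, (a - b * e) / N e ^ 2, ?_⟩
          simp only [map_sub, map_div₀, map_mul, map_pow]
          field_simp
          ring
      refine ⟨τ / (algebraMap K L e + τ) ^ 2, N e ^ 2, div_ne_zero hτ0 (pow_ne_zero 2 hse), ?_,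
        pow_ne_zero 2 (hN0 e), hm, ?_⟩
      · rw [hue, hth, map_pow]; field_simp
      intro j hj
      rw [hm] at hj
      obtain ⟨a, b, h⟩ := hj
      cases j with
      | none =>
        exfalso
        rw [h1inf] at h
        have h' : (algebraMap K L e + τ) ^ 2 = algebraMap K L a + algebraMap K L b * τ := by
          field_simp at h
          linear_combination h
        obtain ⟨p1, p2, p3⟩ := hli (e ^ 2 - a) (2 * e - b) 1 (by
          simp only [map_sub, map_mul, map_pow, map_one, map_ofNat]
          linear_combination h')
        exact one_ne_zero p3
      | some f =>
        rw [h1e, hth] at h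
        have hsf := hs0 f
        have h' : algebraMap K L (N f) * (algebraMap K L e + τ) ^ 2 =
            (algebraMap K L f + τ) * (algebraMap K L a + algebraMap K L b * τ) := by
          field_simp at h
          linear_combination h
        obtain ⟨p1, p2, p3⟩ := hli (N f * e ^ 2 - f * a) (N f * (2 * e) - f * b - a) (N f - b) (by
          simp only [map_sub, map_mul, map_pow, map_ofNat]
          linear_combination h')
        have : N f * (e - f) ^ 2 = 0 := by
          linear_combination p1 - f * p2 + f ^ 2 * p3
        have := (mul_eq_zero.1 this).resolve_left (hN0 f)
        rw [sub_eq_zero.1 (pow_eq_zero_iff (two_ne_zero)|>.1 this)]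
  intro i
  obtain ⟨v, a, hv, hu, ha, hm, ht⟩ := key i
  obtain ⟨r1, r2, r3, r4, r5⟩ := aux_main K L τ (tv₁ i) (tv₂ i) (u i) v a hli hv hu ha hm
  rw [← hW i] at r1 r3 r4 r5
  refine ⟨r1, ⟨r1, r4, r5⟩, r5, r3, r2, ?_, ?_⟩
  · rw [Projectivization.submodule_mk, Submodule.span_singleton_le_iff_mem]
    exact Submodule.subset_span (by simp)
  · rintro P ⟨j, rfl⟩ hP
    simp only [Projectivization.submodule_mk, Submodule.span_singleton_le_iff_mem] at hP
    have := ht j hP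
    subst this
    rfl

end
end
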